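/- arXiv:2001.09597 — 3 statements merged into one kernel-verified Lean document; each statement's English description precedes it below -/
import Mathlib

section
/- Let G be a finite insoluble totally 2-closed group with non-trivial Fitting subgroup F(G), and suppose G has minimal order with these properties (i.e., every finite insoluble totally 2-closed group of order strictly less than |G| has trivial Fitting subgroup). Then F(G) = Z(G), the center Z(G) is cyclic, and the quotient G/Z(G) has a unique minimal normal subgroup, which is nonabelian. -/
def twoClosure {Ω : Type*} (H : Subgroup (Equiv.Perm Ω)) : Subgroup (Equiv.Perm Ω) where
  carrier := {θ | ∀ α β : Ω, ∃ h ∈ H, θ α = h α ∧ θ β = h β}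
  one_mem' := fun α β => ⟨1, H.one_mem, rfl, rfl⟩
  mul_mem' := by
    intro a b ha hb α β
    obtain ⟨h₂, h₂H, e1, e2⟩ := hb α β
    obtain ⟨h₁, h₁H, f1, f2⟩ := ha (b α) (b β)
    refine ⟨h₁ * h₂, H.mul_mem h₁H h₂H, ?_, ?_⟩
    · simp only [Equiv.Perm.mul_apply]; rw [f1, e1]
    · simp only [Equiv.Perm.mul_apply]; rw [f2, e2]
  inv_mem' := by
    intro a ha α β
    obtain ⟨h, hH, e1, e2⟩ := ha (a⁻¹ α) (a⁻¹ β)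
    refine ⟨h⁻¹, H.inv_mem hH, ?_, ?_⟩
    · have h1 : h (a⁻¹ α) = α := by rw [← e1]; simp
      exact Equiv.Perm.eq_inv_iff_eq.mpr h1
    · have h2 : h (a⁻¹ β) = β := by rw [← e2]; simp
      exact Equiv.Perm.eq_inv_iff_eq.mpr h2

def IsTotally2Closed (G : Type*) [Group G] : Prop :=
  ∀ (Ω : Type*) (H : Subgroup (Equiv.Perm Ω)), Nonempty (G ≃* H) → twoClosure H = H

def IsGeneralizedQuaternion (Q : Type*) [Group Q] : Prop :=
  ∃ m : ℕ, 1 ≤ m ∧ Nonempty (Q ≃* QuaternionGroup (2 ^ m))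

def IsFittingSubgroup {G : Type*} [Group G] (F : Subgroup G) : Prop :=
  F.Normal ∧ Group.IsNilpotent F ∧
    ∀ N : Subgroup G, N.Normal → Group.IsNilpotent N → N ≤ F

def IsMinimalNormal {X : Type*} [Group X] (M : Subgroup X) : Prop :=
  M.Normal ∧ M ≠ ⊥ ∧ ∀ N : Subgroup X, N.Normal → N ≤ M → N = ⊥ ∨ N = M


universe u1 v1 w1

section part0

def TwC (G : Type u1) [Group G] : Prop :=
  ∀ (Ω : Type w1) [MulAction G Ω] [FaithfulSMul G Ω] [Finite Ω] (θ : Equiv.Perm Ω),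
    (∀ a b : Ω, ∃ g : G, θ a = g • a ∧ θ b = g • b) → ∃ g : G, ∀ ω, θ ω = g • ω

theorem twc_of {G : Type u1} [Group G] (h : IsTotally2Closed.{u1, v1} G) : TwC.{u1, w1} G := by
  intro Ω _ _ _ θ hθ
  obtain ⟨n, ⟨e⟩⟩ := Finite.exists_equiv_fin Ω
  let e' : Ω ≃ ULift.{v1} (Fin n) := e.trans Equiv.ulift.symm
  let f : G →* Equiv.Perm (ULift.{v1} (Fin n)) :=
    (e'.permCongrHom.toMonoidHom).comp (MulAction.toPermHom G Ω)
  have hf : Function.Injective f := by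
    intro a b hab
    have := e'.permCongrHom.injective hab
    exact MulAction.toPerm_injective this
  have h1 := h _ f.range ⟨MonoidHom.ofInjective hf⟩
  have h2 : e'.permCongrHom θ ∈ twoClosure f.range := by
    intro a b
    obtain ⟨g, h1, h2⟩ := hθ (e'.symm a) (e'.symm b)
    refine ⟨f g, ⟨g, rfl⟩, ?_, ?_⟩
    · simp [f, h1, Equiv.permCongr_apply]
    · simp [f, h2, Equiv.permCongr_apply]
  rw [h1] at h2
  obtain ⟨g, hg⟩ := h2
  refine ⟨g, fun ω => ?_⟩
  have := e'.permCongrHom.injective hg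
  rw [← this]; rfl

theorem of_twc {G : Type u1} [Group G] [Finite G] (h : TwC.{u1, v1} G) :
    IsTotally2Closed.{u1, v1} G := by
  intro Ω H ⟨e⟩
  refine le_antisymm ?_ fun x hx a b => ⟨x, hx, rfl, rfl⟩
  intro θ hθ
  -- action
  letI : MulAction G Ω := MulAction.compHom Ω ((H.subtype).comp e.toMonoidHom)
  have hs : ∀ (g : G) (a : Ω), g • a = (e g : Equiv.Perm Ω) a := fun g a => rfl
  have hθ' : ∀ a b : Ω, ∃ g : G, θ a = g • a ∧ θ b = g • b := by
    intro a b
    obtain ⟨k, hk, h1, h2⟩ := hθ a b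
    refine ⟨e.symm ⟨k, hk⟩, ?_, ?_⟩ <;> simp [hs, h1, h2]
  have hne : ∀ g : G, g ≠ 1 → ∃ a : Ω, g • a ≠ a := by
    intro g hg
    by_contra hcon
    push Not at hcon
    apply hg
    apply e.injective
    ext a
    simp [← hs, hcon]
  rcases isEmpty_or_nonempty Ω with hem | hem
  · have : θ = 1 := by ext a; exact hem.elim a
    rw [this]; exact H.one_mem
  choose! c hc using hne
  -- general: for every finite invariant set that's faithful
  have key : ∀ s : Set Ω, s.Finite → (∀ g : G, g ≠ 1 → c g ∈ s) →
      (∀ (g : G) (a : Ω), a ∈ s → g • a ∈ s) → ∃ g : G, ∀ a ∈ s, θ a = g • a := by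
    intro s hs1 hs2 hs3
    letI : MulAction G s :=
      { smul := fun g a => ⟨g • a.1, hs3 g a.1 a.2⟩
        one_smul := fun a => Subtype.ext (one_smul G a.1)
        mul_smul := fun g k a => Subtype.ext (mul_smul g k a.1) }
    have hcoe : ∀ (g : G) (a : s), ((g • a : s) : Ω) = g • a.1 := fun _ _ => rfl
    haveI : Finite s := hs1
    haveI : FaithfulSMul G s := by
      constructor
      intro g k hgk
      by_contra hne
      have h1 : k⁻¹ * g ≠ 1 := by
        intro h1; apply hne; exact (inv_mul_eq_one.mp h1).symm
      have := hc _ h1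
      apply this
      have h2 := congrArg Subtype.val (hgk ⟨c (k⁻¹ * g), hs2 _ h1⟩)
      rw [hcoe, hcoe] at h2
      simp only at h2
      rw [mul_smul, h2, inv_smul_smul]
    have hmem : ∀ a, a ∈ s ↔ θ a ∈ s := by
      intro a
      obtain ⟨g, hg, -⟩ := hθ' a a
      rw [hg]
      refine ⟨hs3 g a, fun h => ?_⟩
      have := hs3 g⁻¹ _ h
      simpa using this
    obtain ⟨g, hg⟩ := h s (θ.subtypePerm (fun a => (hmem a).symm)) (by
      intro a b
      obtain ⟨g, h1, h2⟩ := hθ' a.1 b.1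
      exact ⟨g, Subtype.ext h1, Subtype.ext h2⟩)
    exact ⟨g, fun a ha => congrArg Subtype.val (hg ⟨a, ha⟩)⟩
  -- the base set
  let Δ : Set Ω := Set.range (fun p : G × G => p.1 • c p.2)
  have hΔf : Δ.Finite := Set.finite_range _
  have hΔ1 : ∀ g : G, g ≠ 1 → c g ∈ Δ := fun g _ => ⟨(1, g), by simp⟩
  have hΔ2 : ∀ (g : G) (a : Ω), a ∈ Δ → g • a ∈ Δ := by
    rintro g _ ⟨p, rfl⟩
    exact ⟨(g * p.1, p.2), by simp [mul_smul]⟩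
  obtain ⟨g, hg⟩ := key Δ hΔf hΔ1 hΔ2
  have hall : ∀ a, θ a = g • a := by
    intro a
    obtain ⟨k, hk⟩ := key (Δ ∪ Set.range (fun x : G => x • a))
      (hΔf.union (Set.finite_range _)) (fun x hx => Or.inl (hΔ1 x hx)) (by
        rintro x b (hb | ⟨y, rfl⟩)
        · exact Or.inl (hΔ2 x b hb)
        · exact Or.inr ⟨x * y, by simp [mul_smul]⟩)
    have hgk : k⁻¹ * g = 1 := by
      by_contra h1
      have h2 := hΔ1 _ h1
      have h3 := hg _ h2
      rw [hk _ (Or.inl h2)] at h3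
      apply hc _ h1
      rw [mul_smul, ← h3, inv_smul_smul]
    rw [hk a (Or.inr ⟨1, by simp⟩), inv_mul_eq_one.mp hgk]
  have : θ = (e g : Equiv.Perm Ω) := by
    ext a; rw [hall a, hs]
  rw [this]; exact (e g).2

end part0

section part1

theorem twc_normal {G : Type u1} [Group G] [Finite G] (h : TwC.{u1, max u1 w1} G)
    (K : Subgroup G) [K.Normal]
    (hC : ∀ g : G, ∃ c ∈ Subgroup.centralizer (K : Set G), ∃ k ∈ K, g = c * k) :
    TwC.{u1, w1} K := by
  intro Ω _ _ _ θ hθ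
  rcases isEmpty_or_nonempty Ω with hem | ⟨⟨ω0⟩⟩
  · exact ⟨1, fun ω => hem.elim ω⟩
  have hs : ∀ q : G ⧸ K, ∃ s ∈ Subgroup.centralizer (K : Set G), (QuotientGroup.mk s : G ⧸ K) = q := by
    intro q
    obtain ⟨g, rfl⟩ := QuotientGroup.mk_surjective q
    obtain ⟨c, hc, k, hk, rfl⟩ := hC g
    refine ⟨c, hc, ?_⟩
    rw [QuotientGroup.eq]; simpa using hk
  choose s hs1 hs2 using hs
  have hmem : ∀ (g : G) (q : G ⧸ K), (s (g • q))⁻¹ * g * s q ∈ K := by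
    intro g q
    rw [← QuotientGroup.eq_one_iff]
    have e1 : ((g : G) : G ⧸ K) * q = g • q := by
      conv_lhs => rw [← hs2 q]
      conv_rhs => rw [← hs2 q]
      rfl
    rw [QuotientGroup.mk_mul, QuotientGroup.mk_mul, QuotientGroup.mk_inv, hs2, hs2, mul_assoc, e1,
      inv_mul_cancel]
  let A : MulAction G (Ω × (G ⧸ K)) :=
    { smul := fun g p => ((⟨_, hmem g p.2⟩ : K) • p.1, g • p.2)
      one_smul := by
        rintro ⟨ω, q⟩
        apply Prod.ext
        · change (⟨_, hmem 1 q⟩ : K) • ω = ω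
          have : (⟨_, hmem 1 q⟩ : K) = 1 := by
            apply Subtype.ext; simp
          rw [this, one_smul]
        · exact one_smul G q
      mul_smul := by
        rintro g k ⟨ω, q⟩
        apply Prod.ext
        · change (⟨_, hmem (g * k) q⟩ : K) • ω = (⟨_, hmem g (k • q)⟩ : K) • (⟨_, hmem k q⟩ : K) • ω
          rw [← mul_smul]
          congr 1
          apply Subtype.ext
          simp only [Subgroup.coe_mul, mul_smul]
          group
        · exact mul_smul g k q }
  have hsm : ∀ (g : G) (ω : Ω) (q : G ⧸ K), g • (ω, q) = ((⟨_, hmem g q⟩ : K) • ω, g • q) :=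
    fun _ _ _ => rfl
  have hKq : ∀ (k : G), k ∈ K → ∀ q : G ⧸ K, k • q = q := by
    intro k hk q
    conv_lhs => rw [← hs2 q]
    conv_rhs => rw [← hs2 q]
    change ((k * s q : G) : G ⧸ K) = _
    rw [QuotientGroup.mk_mul, (QuotientGroup.eq_one_iff k).2 hk, one_mul]
  have hK : ∀ (k : K) (ω : Ω) (q : G ⧸ K), (k : G) • (ω, q) = (k • ω, q) := by
    intro k ω q
    rw [hsm]
    apply Prod.ext
    · simp only
      congr 1
      apply Subtype.ext
      have := hs1 q
      rw [Subgroup.mem_centralizer_iff] at this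
      simp only [hKq k k.2 q]
      rw [mul_assoc, this k k.2]; group
    · exact hKq k k.2 q
  have h1K : ∀ g : G, g • ((1 : G) : G ⧸ K) = ((1 : G) : G ⧸ K) → g ∈ K := by
    intro g hg
    change ((g * 1 : G) : G ⧸ K) = _ at hg
    rw [mul_one] at hg
    exact (QuotientGroup.eq_one_iff g).1 hg
  have : FaithfulSMul G (Ω × (G ⧸ K)) := by
    constructor
    intro g k hgk
    have e : ∀ p : Ω × (G ⧸ K), (k⁻¹ * g) • p = p := by
      intro p; rw [mul_smul, hgk, inv_smul_smul]
    have h1 : k⁻¹ * g ∈ K := h1K _ (congrArg Prod.snd (e (ω0, ((1 : G) : G ⧸ K))))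
    have h2 : (⟨_, h1⟩ : K) = 1 := by
      apply FaithfulSMul.eq_of_smul_eq_smul (α := Ω)
      intro ω
      have := e (ω, ((1 : G) : G ⧸ K))
      rw [hK ⟨_, h1⟩] at this
      rw [one_smul]
      exact congrArg Prod.fst this
    exact (inv_mul_eq_one.mp (congrArg Subtype.val h2)).symm
  obtain ⟨g, hg⟩ := h (Ω × (G ⧸ K)) (Equiv.prodCongr θ (Equiv.refl _)) (by
    rintro ⟨a, q⟩ ⟨b, q'⟩
    obtain ⟨k, h1, h2⟩ := hθ a b
    refine ⟨k, ?_, ?_⟩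
    · rw [hK, ← h1]; rfl
    · rw [hK, ← h2]; rfl)
  have h1 : g ∈ K := h1K _ (congrArg Prod.snd (hg (ω0, ((1 : G) : G ⧸ K)))).symm
  refine ⟨⟨g, h1⟩, fun ω => ?_⟩
  have := hg (ω, ((1 : G) : G ⧸ K))
  rw [hK ⟨g, h1⟩] at this
  exact congrArg Prod.fst this

/-- AB criterion -/
theorem twc_AB {G : Type u1} [Group G] [Finite G] (h : TwC.{u1, u1} G)
    (H0 H1 : Subgroup G) (hcore : H0.normalCore ⊓ H1.normalCore = ⊥) (a : G)
    (ha : ∀ x y : G, ∃ h1 ∈ H1, ∃ h0 ∈ H0, a = (y * h1 * y⁻¹) * (x * h0 * x⁻¹)) :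
    ∃ g ∈ H1.normalCore, a⁻¹ * g ∈ H0.normalCore := by
  have hsm : ∀ (H : Subgroup G) (g x : G), g • (QuotientGroup.mk x : G ⧸ H) = QuotientGroup.mk (g * x) :=
    fun _ _ _ => rfl
  let A : MulAction G ((G ⧸ H0) ⊕ (G ⧸ H1)) :=
    { smul := fun g => Sum.map (fun q => g • q) (fun q => g • q)
      one_smul := by
        rintro (q | q)
        · exact congrArg Sum.inl (one_smul G q)
        · exact congrArg Sum.inr (one_smul G q)
      mul_smul := by
        rintro g k (q | q)
        · exact congrArg Sum.inl (mul_smul g k q)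
        · exact congrArg Sum.inr (mul_smul g k q) }
  have hl : ∀ (g : G) (q : G ⧸ H0), g • (Sum.inl q : (G ⧸ H0) ⊕ (G ⧸ H1)) = Sum.inl (g • q) :=
    fun _ _ => rfl
  have hr : ∀ (g : G) (q : G ⧸ H1), g • (Sum.inr q : (G ⧸ H0) ⊕ (G ⧸ H1)) = Sum.inr (g • q) :=
    fun _ _ => rfl
  have hc : ∀ (H : Subgroup G) (g : G), (∀ q : G ⧸ H, g • q = q) → g ∈ H.normalCore := by
    intro H g hg b
    have := hg (QuotientGroup.mk b⁻¹)
    rw [hsm, QuotientGroup.eq] at this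
    have := H.inv_mem this
    simpa [mul_assoc] using this
  have : FaithfulSMul G ((G ⧸ H0) ⊕ (G ⧸ H1)) := by
    constructor
    intro g k hgk
    have e : ∀ p : (G ⧸ H0) ⊕ (G ⧸ H1), (k⁻¹ * g) • p = p := by
      intro p; rw [mul_smul, hgk, inv_smul_smul]
    have h1 : k⁻¹ * g ∈ H0.normalCore ⊓ H1.normalCore := by
      refine ⟨hc _ _ fun q => ?_, hc _ _ fun q => ?_⟩
      · have := e (Sum.inl q)
        rw [hl] at this
        exact Sum.inl_injective this
      · have := e (Sum.inr q)
        rw [hr] at this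
        exact Sum.inr_injective this
    rw [hcore, Subgroup.mem_bot] at h1
    exact (inv_mul_eq_one.mp h1).symm
  obtain ⟨g, hg⟩ := h ((G ⧸ H0) ⊕ (G ⧸ H1)) (Equiv.sumCongr (MulAction.toPerm a) (Equiv.refl _)) (by
    have key : ∀ (p : G ⧸ H0) (q : G ⧸ H1), ∃ g : G, a • p = g • p ∧ q = g • q := by
      intro p q
      obtain ⟨x, rfl⟩ := QuotientGroup.mk_surjective p
      obtain ⟨y, rfl⟩ := QuotientGroup.mk_surjective q
      obtain ⟨h1, hh1, h0, hh0, e⟩ := ha x y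
      refine ⟨y * h1 * y⁻¹, ?_, ?_⟩
      · rw [hsm, hsm, e, QuotientGroup.eq]
        have := H0.inv_mem hh0
        convert this using 1
        group
      · rw [hsm, QuotientGroup.eq]
        convert hh1 using 1
        group
    rintro (p | p) (q | q)
    · exact ⟨a, rfl, rfl⟩
    · obtain ⟨g, e1, e2⟩ := key p q
      exact ⟨g, congrArg Sum.inl e1, congrArg Sum.inr e2⟩
    · obtain ⟨g, e1, e2⟩ := key q p
      exact ⟨g, congrArg Sum.inr e2, congrArg Sum.inl e1⟩
    · exact ⟨1, by rw [one_smul]; rfl, by rw [one_smul]; rfl⟩)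
  refine ⟨g, hc _ _ fun q => ?_, hc _ _ fun q => ?_⟩
  · exact (Sum.inr_injective (hg (Sum.inr q))).symm
  · have : a • q = g • q := Sum.inl_injective (hg (Sum.inl q))
    rw [mul_smul, ← this, inv_smul_smul]

end part1

section partV

variable {G : Type u1} [Group G]

theorem exists_ne_one_of_ne_bot {H : Subgroup G} (h : H ≠ ⊥) : ∃ x ∈ H, x ≠ 1 := by
  by_contra hc
  push Not at hc
  exact h (by rw [eq_bot_iff]; intro x hx; simpa using hc x hx)

def comProd (A B : Subgroup G) (hc : ∀ a ∈ A, ∀ b ∈ B, a * b = b * a) : Subgroup G where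
  carrier := {x | ∃ a ∈ A, ∃ b ∈ B, x = a * b}
  one_mem' := ⟨1, A.one_mem, 1, B.one_mem, by simp⟩
  mul_mem' := by
    rintro _ _ ⟨a, ha, b, hb, rfl⟩ ⟨a', ha', b', hb', rfl⟩
    refine ⟨a * a', A.mul_mem ha ha', b * b', B.mul_mem hb hb', ?_⟩
    rw [mul_assoc, ← mul_assoc b, ← hc a' ha' b hb]; group
  inv_mem' := by
    rintro _ ⟨a, ha, b, hb, rfl⟩
    refine ⟨a⁻¹, A.inv_mem ha, b⁻¹, B.inv_mem hb, ?_⟩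
    rw [hc a ha b hb]; group

theorem hyper_exists [Finite G] {p : ℕ} (hp : p.Prime) (V : Subgroup G)
    (hab : ∀ a ∈ V, ∀ b ∈ V, a * b = b * a) (hel : ∀ a ∈ V, a ^ p = 1)
    (W : Subgroup G) (hWV : W ≤ V) (y : G) (hy : y ∈ V) (hyW : y ∉ W) :
    ∃ B : Subgroup G, W ≤ B ∧ y ∉ B ∧ B ⋖ V := by
  obtain ⟨B, hWB, hB⟩ := (Set.toFinite {B : Subgroup G | B ≤ V ∧ y ∉ B}).exists_le_maximal
    (a := W) ⟨hWV, hyW⟩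
  obtain ⟨⟨hBV, hyB⟩, hmax⟩ := hB
  refine ⟨B, hWB, hyB, ?_⟩
  have hin : ∀ C : Subgroup G, B < C → C ≤ V → y ∈ C := by
    intro C hBC hCV
    by_contra hyC
    exact hBC.not_ge (hmax ⟨hCV, hyC⟩ hBC.le)
  refine ⟨lt_of_le_of_ne hBV (fun h => hyB (h ▸ hy)), ?_⟩
  intro C hBC hCV
  have hyC := hin C hBC hCV.le
  apply hCV.not_ge
  intro x hx
  by_cases hxB : x ∈ B
  · exact hBC.le hxB
  have hc : ∀ a ∈ B, ∀ b ∈ Subgroup.zpowers x, a * b = b * a := by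
    intro a ha b hb
    exact hab a (hBV ha) b ((Subgroup.zpowers_le.2 hx) hb)
  have h1 : y ∈ comProd B (Subgroup.zpowers x) hc := by
    apply hin
    · refine lt_of_le_of_ne (fun b hb => ⟨b, hb, 1, one_mem _, by simp⟩) ?_
      intro h
      apply hxB
      rw [h]
      exact ⟨1, one_mem _, x, Subgroup.mem_zpowers x, by simp⟩
    · rintro _ ⟨b, hb, z, hz, rfl⟩
      exact V.mul_mem (hBV hb) ((Subgroup.zpowers_le.2 hx) hz)
  obtain ⟨b, hb, z, ⟨k, rfl⟩, hyz⟩ := h1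
  simp only at hyz
  have hk : IsCoprime k (p : ℤ) := by
    rw [isCoprime_comm, Prime.coprime_iff_not_dvd (Nat.prime_iff_prime_int.mp hp)]
    rintro ⟨m, rfl⟩
    apply hyB
    rw [hyz, zpow_mul, zpow_natCast, hel x hx, one_zpow, mul_one]
    exact hb
  obtain ⟨s, t, hst⟩ := hk
  have : x = (x ^ k) ^ s := by
    have h2 : x ^ (t * (p : ℤ)) = 1 := by
      rw [mul_comm, zpow_mul, zpow_natCast, hel x hx, one_zpow]
    calc x = x ^ (s * k + t * (p : ℤ)) := by rw [hst, zpow_one]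
      _ = (x ^ k) ^ s := by rw [zpow_add, h2, mul_one, mul_comm, zpow_mul]
  rw [this]
  apply C.zpow_mem
  have : x ^ k = b⁻¹ * y := by rw [hyz]; group
  rw [this]
  exact C.mul_mem (C.inv_mem (hBC.le hb)) hyC

theorem elem_cyclic [Finite G] (h : TwC.{u1, u1} G) {p : ℕ} (hp : p.Prime) (V : Subgroup G)
    [V.Normal]
    (hab : ∀ a ∈ V, ∀ b ∈ V, a * b = b * a) (hel : ∀ a ∈ V, a ^ p = 1) :
    ∃ v ∈ V, V = Subgroup.zpowers v := by
  by_cases hV : V = ⊥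
  · exact ⟨1, one_mem _, by simp [hV]⟩
  obtain ⟨v, hv, hv1⟩ := exists_ne_one_of_ne_bot hV
  by_contra hcyc
  push Not at hcyc
  obtain ⟨U', -, hvU', hU'⟩ := hyper_exists hp V hab hel ⊥ bot_le v hv (by simpa using hv1)
  have hU'n : U' ≠ ⊥ := by
    rintro rfl
    rcases hU'.eq_or_eq bot_le (Subgroup.zpowers_le.2 hv) with h | h
    · rw [Subgroup.zpowers_eq_bot] at h; exact hv1 h
    · exact hcyc v hv h.symm
  obtain ⟨y, hyU, hy1⟩ := exists_ne_one_of_ne_bot hU'n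
  let Ω := Σ U : {U : Subgroup G // U ⋖ V}, G ⧸ U.1
  have hstab1 : ∀ U : {U : Subgroup G // U ⋖ V},
      MulAction.stabilizer G (⟨U, ((1 : G) : G ⧸ U.1)⟩ : Ω) = U.1 := by
    intro U
    ext g
    rw [MulAction.mem_stabilizer_iff]
    have : g • (⟨U, ((1 : G) : G ⧸ U.1)⟩ : Ω) = ⟨U, (g : G ⧸ U.1)⟩ := by
      change (⟨U, ((g * 1 : G) : G ⧸ U.1)⟩ : Ω) = _
      rw [mul_one]
    rw [this]
    constructor
    · intro h
      have h2 : ((g : G) : G ⧸ U.1) = ((1 : G) : G ⧸ U.1) := by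
        simpa using h
      rw [eq_comm, QuotientGroup.eq] at h2
      simpa using h2
    · intro hg
      have h2 : ((1 : G) : G ⧸ U.1) = ((g : G) : G ⧸ U.1) := by
        rw [QuotientGroup.eq]; simpa using hg
      rw [h2]
  have hstab : ∀ ω : Ω, MulAction.stabilizer G ω ⋖ V := by
    rintro ⟨U, q⟩
    obtain ⟨x, rfl⟩ := QuotientGroup.mk_surjective q
    have : (⟨U, (x : G ⧸ U.1)⟩ : Ω) = x • (⟨U, ((1 : G) : G ⧸ U.1)⟩ : Ω) := by
      change _ = (⟨U, ((x * 1 : G) : G ⧸ U.1)⟩ : Ω)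
      rw [mul_one]
    rw [this, MulAction.stabilizer_smul_eq_stabilizer_map_conj, hstab1]
    have e := apply_covBy_apply_iff (MulAut.conj x).mapSubgroup (a := U.1) (b := V)
    have e2 : (MulAut.conj x).mapSubgroup V = V := Subgroup.Normal.map_conj_eq V x
    rw [e2] at e
    exact e.2 U.2
  have hfaith : FaithfulSMul G Ω := by
    constructor
    intro g k hgk
    have e : ∀ p : Ω, (k⁻¹ * g) ∈ MulAction.stabilizer G p := by
      intro p; rw [MulAction.mem_stabilizer_iff, mul_smul, hgk, inv_smul_smul]
    have h1 : k⁻¹ * g ∈ V := by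
      have := e ⟨⟨U', hU'⟩, ((1 : G) : G ⧸ U')⟩
      exact (hstab _).le this
    have h2 : k⁻¹ * g = 1 := by
      by_contra hne
      obtain ⟨B, -, hB1, hB2⟩ := hyper_exists hp V hab hel ⊥ bot_le _ h1 (by simpa using hne)
      have := e ⟨⟨B, hB2⟩, ((1 : G) : G ⧸ B)⟩
      rw [hstab1] at this
      exact hB1 this
    exact (inv_mul_eq_one.mp h2).symm
  have hDv : ∀ w ∈ V, ∀ ω : Ω, MulAction.stabilizer G ω = U' → MulAction.stabilizer G (w • ω) = U' := by
    intro w hw ω hω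
    rw [MulAction.stabilizer_smul_eq_stabilizer_map_conj, hω]
    ext x
    rw [Subgroup.mem_map]
    constructor
    · rintro ⟨z, hz, rfl⟩
      have := hab w hw z (hU'.le hz)
      simp [this]; exact hz
    · intro hx
      refine ⟨x, hx, ?_⟩
      have := hab w hw x (hU'.le hx)
      simp [this]
  classical
  let f : G → Ω → Ω := fun w ω => if MulAction.stabilizer G ω = U' then w • ω else ω
  have hff : ∀ w w' : G, w' ∈ V → w * w' = 1 → ∀ ω, f w (f w' ω) = ω := by
    intro w w' hw' hww ω
    by_cases hω : MulAction.stabilizer G ω = U'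
    · have h2 := hDv w' hw' ω hω
      simp only [f, hω, h2, if_true]
      rw [← mul_smul, hww, one_smul]
    · simp only [f, hω, if_false]
  let θ : Equiv.Perm Ω := ⟨f v, f v⁻¹, hff _ _ hv (by simp), hff _ _ (V.inv_mem hv) (by simp)⟩
  have hprod : ∀ B : Subgroup G, B ⋖ V → B ≠ U' → ∃ b ∈ B, v⁻¹ * b ∈ U' := by
    intro B hB hne
    have hc : ∀ a ∈ B, ∀ b ∈ U', a * b = b * a := fun a ha b hb => hab a (hB.le ha) b (hU'.le hb)
    have h1 : B ≤ comProd B U' hc := fun b hb => ⟨b, hb, 1, one_mem _, by simp⟩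
    have h2 : U' ≤ comProd B U' hc := fun b hb => ⟨1, one_mem _, b, hb, by simp⟩
    have h3 : comProd B U' hc ≤ V := by
      rintro _ ⟨b, hb, z, hz, rfl⟩
      exact V.mul_mem (hB.le hb) (hU'.le hz)
    have h4 : comProd B U' hc = V := by
      rcases hB.eq_or_eq h1 h3 with h | h
      · exfalso
        rw [h] at h2
        rcases hU'.eq_or_eq h2 hB.le with h' | h'
        · exact hne h'
        · exact hB.ne h'
      · exact h
    have h5 : v ∈ comProd B U' hc := h4 ▸ hv
    obtain ⟨b, hb, u, hu, e⟩ := h5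
    refine ⟨b, hb, ?_⟩
    have : v⁻¹ * b = u⁻¹ := by rw [e]; group
    rw [this]; exact U'.inv_mem hu
  have hθD : ∀ ω : Ω, MulAction.stabilizer G ω = U' → θ ω = v • ω := fun ω hω => if_pos hω
  have hθN : ∀ ω : Ω, MulAction.stabilizer G ω ≠ U' → θ ω = ω := fun ω hω => if_neg hω
  have hmix : ∀ a b : Ω, MulAction.stabilizer G a = U' → MulAction.stabilizer G b ≠ U' →
      ∃ g : G, θ a = g • a ∧ θ b = g • b := by
    intro a b ha hb
    obtain ⟨g, hg1, hg2⟩ := hprod _ (hstab b) hb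
    refine ⟨g, ?_, ?_⟩
    · rw [hθD a ha]
      rw [← ha, MulAction.mem_stabilizer_iff, mul_smul, inv_smul_eq_iff] at hg2
      exact hg2.symm
    · rw [hθN b hb]
      exact (MulAction.mem_stabilizer_iff.1 hg1).symm
  obtain ⟨g, hg⟩ := h Ω θ (by
    intro a b
    by_cases ha : MulAction.stabilizer G a = U' <;> by_cases hb : MulAction.stabilizer G b = U'
    · exact ⟨v, hθD a ha, hθD b hb⟩
    · exact hmix a b ha hb
    · obtain ⟨g, h1, h2⟩ := hmix b a hb ha
      exact ⟨g, h2, h1⟩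
    · exact ⟨1, by rw [one_smul, hθN a ha], by rw [one_smul, hθN b hb]⟩)
  have hgU : v⁻¹ * g ∈ U' := by
    have e := hstab1 ⟨U', hU'⟩
    have h1 := hg ⟨⟨U', hU'⟩, ((1 : G) : G ⧸ U')⟩
    rw [hθD _ e] at h1
    change v⁻¹ * g ∈ (⟨U', hU'⟩ : {U : Subgroup G // U ⋖ V}).1
    rw [← hstab1 ⟨U', hU'⟩, MulAction.mem_stabilizer_iff, mul_smul, ← h1, inv_smul_smul]
  have hgV : g ∈ V := by
    have : g = v * (v⁻¹ * g) := by group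
    rw [this]; exact V.mul_mem hv (hU'.le hgU)
  have hgnU : g ∉ U' := by
    intro hgU2
    apply hvU'
    have : v = g * (v⁻¹ * g)⁻¹ := by group
    rw [this]; exact U'.mul_mem hgU2 (U'.inv_mem hgU)
  have hyV := hU'.le hyU
  have hgy : g * y⁻¹ ∈ V := V.mul_mem hgV (V.inv_mem hyV)
  have hyW : y ∉ Subgroup.zpowers (g * y⁻¹) := by
    rintro ⟨k, hk⟩
    simp only at hk
    have hcom : Commute g y⁻¹ := hab g hgV y⁻¹ (V.inv_mem hyV)
    have h1 : g ^ k ∈ U' := by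
      rw [hcom.mul_zpow] at hk
      have : g ^ k = y * ((y⁻¹) ^ k)⁻¹ := by
        rw [eq_mul_inv_iff_mul_eq]; exact hk
      rw [this]
      exact U'.mul_mem hyU (U'.inv_mem (U'.zpow_mem (U'.inv_mem hyU) k))
    by_cases hpk : (p : ℤ) ∣ k
    · obtain ⟨m, rfl⟩ := hpk
      rw [zpow_mul, zpow_natCast, hel _ hgy, one_zpow] at hk
      exact hy1 hk.symm
    · rw [← Prime.coprime_iff_not_dvd (Nat.prime_iff_prime_int.mp hp)] at hpk
      obtain ⟨s, t, hst⟩ := hpk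
      apply hgnU
      have : g = (g ^ k) ^ t := by
        have h2 : g ^ (s * (p : ℤ)) = 1 := by
          rw [mul_comm, zpow_mul, zpow_natCast, hel g hgV, one_zpow]
        calc g = g ^ (s * (p : ℤ) + t * k) := by rw [hst, zpow_one]
          _ = (g ^ k) ^ t := by rw [zpow_add, h2, one_mul, mul_comm, zpow_mul]
      rw [this]; exact U'.zpow_mem h1 t
  obtain ⟨B, hB1, hB2, hB3⟩ := hyper_exists hp V hab hel _ (Subgroup.zpowers_le.2 hgy) y hyV hyW
  have hBne : B ≠ U' := by rintro rfl; exact hB2 hyU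
  have hgB : g ∈ B := by
    have e := hstab1 ⟨B, hB3⟩
    have h1 := hg ⟨⟨B, hB3⟩, ((1 : G) : G ⧸ B)⟩
    rw [hθN _ (by rw [e]; exact hBne)] at h1
    change g ∈ (⟨B, hB3⟩ : {U : Subgroup G // U ⋖ V}).1
    rw [← hstab1 ⟨B, hB3⟩, MulAction.mem_stabilizer_iff]
    exact h1.symm
  apply hB2
  have h1 : g * y⁻¹ ∈ B := hB1 (Subgroup.mem_zpowers _)
  have : y = (g * y⁻¹)⁻¹ * g := by group
  rw [this]; exact B.mul_mem (B.inv_mem h1) hgB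

theorem abel_cyclic [Finite G] (h : TwC.{u1, u1} G) (F : Subgroup G) [F.Normal]
    (hab : ∀ a ∈ F, ∀ b ∈ F, a * b = b * a) : IsCyclic F := by
  classical
  let V : ℕ → Subgroup G := fun n =>
    { carrier := {x | x ∈ F ∧ x ^ n = 1}
      one_mem' := ⟨one_mem _, one_pow _⟩
      mul_mem' := by
        rintro a b ⟨ha, ha'⟩ ⟨hb, hb'⟩
        refine ⟨F.mul_mem ha hb, ?_⟩
        rw [(show Commute a b from hab a ha b hb).mul_pow, ha', hb', one_mul]
      inv_mem' := by
        rintro a ⟨ha, ha'⟩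
        exact ⟨F.inv_mem ha, by rw [inv_pow, ha', inv_one]⟩ }
  have hVm : ∀ n x, x ∈ V n ↔ x ∈ F ∧ x ^ n = 1 := fun _ _ => Iff.rfl
  have hp : ∀ p : ℕ, p.Prime → Nat.card (V p) ≤ p := by
    intro p hp
    have hn : (V p).Normal := by
      constructor
      rintro x ⟨hx, hx'⟩ g
      refine ⟨‹F.Normal›.conj_mem x hx g, ?_⟩
      rw [conj_pow, hx']; simp
    obtain ⟨v, hv, e⟩ := elem_cyclic h hp (V p) (fun a ha b hb => hab a ha.1 b hb.1)
      (fun a ha => ha.2)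
    rw [e, Nat.card_zpowers]
    exact Nat.le_of_dvd hp.pos (orderOf_dvd_of_pow_eq_one hv.2)
  have hall : ∀ n : ℕ, 0 < n → Nat.card (V n) ≤ n := by
    intro n
    induction n using induction_on_primes with
    | zero => intro h; omega
    | one =>
      intro _
      have : V 1 = ⊥ := by
        rw [eq_bot_iff]; rintro x ⟨_, hx⟩; simpa using hx
      rw [this]; simp
    | prime_mul p m hpp ih =>
      intro hpos
      have hm : 0 < m := Nat.pos_of_mul_pos_left hpos
      let f : V (p * m) →* V m :=
        { toFun := fun x => ⟨x.1 ^ p, F.pow_mem x.2.1 p, by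
            rw [← pow_mul]; exact x.2.2⟩
          map_one' := by apply Subtype.ext; simp
          map_mul' := by
            intro a b; apply Subtype.ext
            exact (show Commute a.1 b.1 from hab _ a.2.1 _ b.2.1).mul_pow p }
      have h1 := Subgroup.card_mul_index f.ker
      rw [Subgroup.index_ker] at h1
      have h2 : Nat.card f.range ≤ m := (Subgroup.card_le_card_group _).trans (ih hm)
      have h3 : Nat.card f.ker ≤ p := by
        refine le_trans ?_ (hp p hpp)
        refine Nat.card_le_card_of_injective
          (fun x : f.ker => (⟨x.1.1, x.1.2.1, ?_⟩ : V p)) ?_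
        · have := congrArg Subtype.val (MonoidHom.mem_ker.1 x.2)
          exact this
        · intro a b hab
          apply Subtype.ext; apply Subtype.ext
          exact congrArg (fun z => z.1) hab
      rw [← h1]
      exact Nat.mul_le_mul h3 h2
  have : Fintype F := Fintype.ofFinite F
  apply isCyclic_of_card_pow_eq_one_le
  intro n hn
  refine le_trans ?_ (hall n hn)
  rw [← Fintype.card_coe, ← Nat.card_eq_fintype_card]
  refine Nat.card_le_card_of_injective (fun x => (⟨x.1.1, x.1.2, ?_⟩ : V n)) ?_
  · have h1 := x.2
    simp only [Finset.mem_filter, Finset.mem_univ, true_and] at h1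
    have := congrArg Subtype.val h1
    simpa using this
  · intro a b hab
    apply Subtype.ext; apply Subtype.ext
    exact congrArg (fun z => z.1) hab

end partV

section partSmall

theorem simple_sylow {G : Type u1} [Group G] [Finite G] [IsSimpleGroup G]
    (hns : ¬ Group.IsSolvable G) {p a m : ℕ} (hp : p.Prime) (hcard : Nat.card G = p ^ a * m)
    (ha : a ≠ 0) (hm : ¬ p ∣ m) :
    ∃ s, s ∣ m ∧ s % p = 1 ∧ s ≠ 1 ∧ Nat.card G ∣ s.factorial ∧ (a ≤ 2 → s ≠ m) ∧
      ∃ H : Subgroup G, H.index = s := by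
  have : Fact p.Prime := ⟨hp⟩
  have hpos : 0 < m := Nat.pos_of_ne_zero (by rintro rfl; simp at hm)
  let P : Sylow p G := default
  have hPc : Nat.card P = p ^ a := by
    rw [Sylow.card_eq_multiplicity, hcard, Nat.factorization_mul (by simp [hp.ne_zero]) hpos.ne']
    simp [hp.factorization_self, Nat.factorization_eq_zero_of_not_dvd hm]
  have hidx : (P : Subgroup G).index = m := by
    have h1 := Subgroup.card_mul_index (P : Subgroup G)
    rw [hcard] at h1
    have h2 : Nat.card (P : Subgroup G) = p ^ a := hPc
    rw [h2] at h1
    exact Nat.eq_of_mul_eq_mul_left (pow_pos hp.pos _) h1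
  have hPne : (P : Subgroup G) ≠ ⊥ := by
    intro h
    have h2 : Nat.card (P : Subgroup G) = p ^ a := hPc
    rw [h, Subgroup.card_bot] at h2
    exact absurd h2.symm (Nat.one_lt_pow ha hp.one_lt).ne'
  have hPnt : (P : Subgroup G) ≠ ⊤ := by
    intro h
    apply hns
    have h1 : IsPGroup p (⊤ : Subgroup G) := h ▸ P.2
    have h2 : IsPGroup p G := by
      intro x
      obtain ⟨k, hk⟩ := h1 ⟨x, trivial⟩
      exact ⟨k, congrArg Subtype.val hk⟩
    have := h2.isNilpotent
    infer_instance
  have hNP : (Subgroup.normalizer (P : Set G)) ≠ ⊤ := by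
    intro h
    have hn : (P : Subgroup G).Normal := Subgroup.normalizer_eq_top_iff.1 h
    rcases hn.eq_bot_or_eq_top with h | h
    · exact hPne h
    · exact hPnt h
  have hs := Sylow.card_eq_index_normalizer P
  refine ⟨Nat.card (Sylow p G), ?_, ?_, ?_, ?_, ?_, ⟨_, hs.symm⟩⟩
  · rw [← hidx]; exact P.card_dvd_index
  · have := card_sylow_modEq_one p G
    unfold Nat.ModEq at this
    rwa [Nat.mod_eq_of_lt hp.one_lt] at this
  · intro h1
    rw [hs, Subgroup.index_eq_one] at h1
    exact hNP h1
  · have hinj : Function.Injective (MulAction.toPermHom G (Sylow p G)) := by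
      rw [← MonoidHom.ker_eq_bot_iff]
      rcases (MonoidHom.normal_ker (MulAction.toPermHom G (Sylow p G))).eq_bot_or_eq_top with h | h
      · exact h
      · exfalso
        apply hNP
        rw [eq_top_iff]
        intro g _
        have hg : g ∈ (MulAction.toPermHom G (Sylow p G)).ker := h ▸ Subgroup.mem_top g
        rw [MonoidHom.mem_ker] at hg
        have := congrArg (fun f => f P) hg
        simp only [MulAction.toPermHom_apply, MulAction.toPerm_apply, Equiv.Perm.coe_one, id_eq] at this
        exact Sylow.smul_eq_iff_mem_normalizer.1 this
    have := Subgroup.card_dvd_of_injective _ hinj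
    rwa [Nat.card_perm] at this
  · intro ha2 hsm
    have hcomm : IsMulCommutative P := by
      interval_cases a
      · exact absurd rfl ha
      · have : IsCyclic P := isCyclic_of_prime_card (p := p) (by rw [hPc, pow_one])
        exact IsCyclic.isMulCommutative
      · exact IsPGroup.isMulCommutative_of_card_eq_prime_sq hPc
    have hNeq : Subgroup.normalizer (P : Set G) = (P : Subgroup G) := by
      symm
      apply Subgroup.eq_of_le_of_card_ge Subgroup.le_normalizer
      have h1 := Subgroup.card_mul_index (Subgroup.normalizer (P : Set G))
      have h2 := Subgroup.card_mul_index (P : Subgroup G)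
      rw [← hs, hsm] at h1
      rw [hidx, ← h1] at h2
      exact (Nat.eq_of_mul_eq_mul_right hpos h2).ge
    have hle : Subgroup.normalizer (P : Set G) ≤ Subgroup.centralizer (P : Set G) := by
      rw [hNeq]
      intro x hx
      rw [Subgroup.mem_centralizer_iff]
      intro y hy
      exact congrArg Subtype.val (mul_comm' (⟨y, hy⟩ : P) ⟨x, hx⟩)
    have hc := MonoidHom.ker_transferSylow_isComplement' P hle
    rcases (MonoidHom.normal_ker (MonoidHom.transferSylow P hle)).eq_bot_or_eq_top with h | h
    · rw [h] at hc
      exact hPnt (Subgroup.isComplement'_bot_left.1 hc)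
    · rw [h] at hc
      exact hPne (Subgroup.isComplement'_top_left.1 hc)

def smallTest (n : ℕ) : Bool :=
  [2, 3, 5, 7, 11, 13, 17, 19, 23, 29, 31, 37, 41, 43, 47, 53, 59, 61, 67, 71, 73, 79, 83, 89].any
    fun p => [1, 2, 3, 4, 5, 6].any fun a =>
      n % p ^ a == 0 && (n / p ^ a) % p != 0 &&
      (List.range (n / p ^ a + 1)).all fun s =>
        !((n / p ^ a) % s == 0 && s % p == 1 && s != 1 && (decide (6 < s) || (s.factorial % n == 0)) &&
          (decide (2 < a) || s != n / p ^ a))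

theorem smallTest_all : (List.range 91).all (fun n => decide (n < 2) || n == 60 || smallTest n) = true := by
  decide +kernel

theorem small_simple {G : Type u1} [Group G] [Finite G] [IsSimpleGroup G]
    (hns : ¬ Group.IsSolvable G) (hc : Nat.card G ≤ 90) :
    Nat.card G = 60 ∧ ∃ H : Subgroup G, H.index = 5 := by
  have h60 : Nat.card G = 60 := by
    by_contra hne
    have h1 := List.all_eq_true.1 smallTest_all (Nat.card G) (by rw [List.mem_range]; omega)
    have h2 : 2 ≤ Nat.card G := Finite.one_lt_card
    simp only [Bool.or_eq_true, decide_eq_true_eq, beq_iff_eq] at h1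
    have h3 : smallTest (Nat.card G) = true := by
      rcases h1 with (h | h) | h
      · omega
      · exact absurd h hne
      · exact h
    unfold smallTest at h3
    rw [List.any_eq_true] at h3
    obtain ⟨p, hp, h3⟩ := h3
    rw [List.any_eq_true] at h3
    obtain ⟨a, ha, h3⟩ := h3
    rw [Bool.and_eq_true, Bool.and_eq_true, List.all_eq_true] at h3
    obtain ⟨⟨h4, h5⟩, h6⟩ := h3
    have hpp : p.Prime := by
      simp only [List.mem_cons, List.not_mem_nil, or_false] at hp
      rcases hp with h | h | h | h | h | h | h | h | h | h | h | h | h | h | h | h | h | h | h | h | h | h | h | h <;>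
        subst h <;> norm_num
    have ha0 : a ≠ 0 := by
      rintro rfl; simp at ha
    have hd : p ^ a ∣ Nat.card G := Nat.dvd_of_mod_eq_zero (by simpa using h4)
    have hcm : Nat.card G = p ^ a * (Nat.card G / p ^ a) := (Nat.mul_div_cancel' hd).symm
    have hpm : ¬ p ∣ Nat.card G / p ^ a := by
      intro h
      have := Nat.mod_eq_zero_of_dvd h
      simp [this] at h5
    obtain ⟨s, s1, s2, s3, s4, s5, -⟩ := simple_sylow hns hpp hcm ha0 hpm
    have hmpos : 0 < Nat.card G / p ^ a := Nat.pos_of_ne_zero (by intro h; rw [h] at hpm; simp at hpm)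
    have h7 := h6 s (by rw [List.mem_range]; exact Nat.lt_succ_of_le (Nat.le_of_dvd hmpos s1))
    have e1 : (Nat.card G / p ^ a) % s = 0 := Nat.mod_eq_zero_of_dvd s1
    have e2 : s.factorial % Nat.card G = 0 := Nat.mod_eq_zero_of_dvd s4
    have e3 : (decide (2 < a) || s != Nat.card G / p ^ a) = true := by
      by_cases h : 2 < a
      · simp [h]
      · simp [s5 (by omega)]
    rw [e3, e1, e2, s2] at h7
    simp [s3] at h7
  refine ⟨h60, ?_⟩
  obtain ⟨s, s1, s2, s3, s4, s5, H, hH⟩ := simple_sylow (p := 2) (a := 2) (m := 15) hns Nat.prime_two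
    (by rw [h60]; norm_num) (by norm_num) (by norm_num)
  have hs : s ≤ 15 := Nat.le_of_dvd (by norm_num) s1
  have s5' := s5 le_rfl
  rw [h60] at s4
  refine ⟨H, ?_⟩
  rw [hH]
  interval_cases s <;> first | rfl | (exfalso; revert s1 s2 s3 s4 s5'; decide)

theorem small_insoluble : ∀ (n : ℕ) (G : Type u1) [Group G] [Finite G], Nat.card G = n → n ≤ 90 →
    ¬ Group.IsSolvable G → n = 60 ∧ ∃ H : Subgroup G, H.index = 5 := by
  intro n
  induction n using Nat.strong_induction_on with
  | _ n ih =>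
  intro G _ _ hn hle hns
  by_cases hsim : IsSimpleGroup G
  · subst hn; exact small_simple hns hle
  · exfalso
    have hnt : Nontrivial G := by
      by_contra h
      rw [not_nontrivial_iff_subsingleton] at h
      exact hns inferInstance
    have : ∃ N : Subgroup G, N.Normal ∧ N ≠ ⊥ ∧ N ≠ ⊤ := by
      by_contra hcon
      push Not at hcon
      apply hsim
      exact ⟨fun N hN => or_iff_not_imp_left.2 fun h => hcon N hN h⟩
    obtain ⟨N, hN, hN1, hN2⟩ := this
    have h1 := Subgroup.card_mul_index N
    have h2 : Nat.card N ≠ 1 := fun h => hN1 (Subgroup.card_eq_one.1 h)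
    have h3 : N.index ≠ 1 := fun h => hN2 (Subgroup.index_eq_one.1 h)
    have h4 : 0 < Nat.card N := Nat.card_pos
    have h5 : 0 < N.index := Nat.pos_of_ne_zero Subgroup.index_ne_zero_of_finite
    have hsN : Group.IsSolvable N := by
      by_contra hs
      have h6 : 2 * Nat.card N ≤ n := by
        have : 2 ≤ N.index := by omega
        nlinarith
      obtain ⟨h7, -⟩ := ih (Nat.card N) (by omega) N rfl (by omega) hs
      omega
    have hsQ : Group.IsSolvable (G ⧸ N) := by
      by_contra hs
      have h6 : 2 * N.index ≤ n := by
        have : 2 ≤ Nat.card N := by omega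
        nlinarith
      obtain ⟨h7, -⟩ := ih (Nat.card (G ⧸ N)) (by rw [← Subgroup.index_eq_card]; omega) (G ⧸ N) rfl
        (by rw [← Subgroup.index_eq_card]; omega) hs
      rw [← Subgroup.index_eq_card] at h7
      omega
    exact hns (Group.isSolvable_of_ker_le_range N.subtype (QuotientGroup.mk' N) (by simp))

theorem insol_card {G : Type u1} [Group G] [Finite G] (h : ¬ Group.IsSolvable G) : 60 ≤ Nat.card G := by
  by_contra hc
  have := (small_insoluble _ G rfl (by omega) h).1
  omega

end partSmall

section part4

theorem nilp_of_comm {G : Type u1} [Group G] (N : Subgroup G)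
    (h : ∀ a ∈ N, ∀ b ∈ N, a * b = b * a) : Group.IsNilpotent N := by
  let _ : CommGroup N := { (inferInstance : Group N) with
    mul_comm := fun a b => Subtype.ext (h a a.2 b b.2) }
  exact CommGroup.isNilpotent

theorem sol_of_comm {G : Type u1} [Group G] (N : Subgroup G)
    (h : ∀ a ∈ N, ∀ b ∈ N, a * b = b * a) : Group.IsSolvable N := by
  have := nilp_of_comm N h
  infer_instance

theorem sol_sup {G : Type u1} [Group G] (N N' : Subgroup G) [N.Normal] [N'.Normal]
    (h : Group.IsSolvable N) (h' : Group.IsSolvable N') : Group.IsSolvable (N ⊔ N' : Subgroup G) := by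
  have hN : (N.subgroupOf (N ⊔ N')).Normal := inferInstance
  have e := QuotientGroup.quotientInfEquivProdNormalQuotient N' N
  have h1 : Group.IsSolvable (N.subgroupOf (N ⊔ N')) :=
    Group.isSolvable_of_isSolvable_injective
      (f := (Subgroup.subgroupOfEquivOfLe (le_sup_left : N ≤ N ⊔ N')).toMonoidHom)
      (Subgroup.subgroupOfEquivOfLe (le_sup_left : N ≤ N ⊔ N')).injective
  have h2 : Group.IsSolvable ((N' ⊔ N : Subgroup G) ⧸ N.subgroupOf (N' ⊔ N)) :=
    Group.isSolvable_of_surjective (f := e.toMonoidHom) e.surjective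
  rw [sup_comm] at h1 ⊢
  exact (Group.isSolvable_iff_subgroup_quotient (N.subgroupOf (N' ⊔ N))).2 ⟨h1, h2⟩

theorem sol_normal_index {G : Type u1} [Group G] [Finite G] (hG : ¬ Group.IsSolvable G)
    (N : Subgroup G) [N.Normal] (h : Group.IsSolvable N) : 60 ≤ N.index := by
  rw [Subgroup.index_eq_card]
  apply insol_card
  intro hq
  exact hG ((Group.isSolvable_iff_subgroup_quotient N).2 ⟨h, hq⟩)

theorem sol_normal_card {G : Type u1} [Group G] [Finite G] (hG : ¬ Group.IsSolvable G)
    (N : Subgroup G) [N.Normal] (h : Group.IsSolvable N) : 60 * Nat.card N ≤ Nat.card G := by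
  have h1 := sol_normal_index hG N h
  rw [← Subgroup.card_mul_index N, mul_comm]
  exact Nat.mul_le_mul_left _ h1

theorem comm_of_card_le_three {G : Type u1} [Group G] [Finite G] (h : Nat.card G ≤ 3) :
    IsCyclic G := by
  have h1 : 0 < Nat.card G := Nat.card_pos
  have h2 : Nat.card G = 1 ∨ Nat.card G = 2 ∨ Nat.card G = 3 := by omega
  rcases h2 with h2 | h2 | h2
  · have := (Nat.card_eq_one_iff_unique.1 h2).1
    exact isCyclic_of_subsingleton
  · have : Fact (Nat.Prime 2) := ⟨Nat.prime_two⟩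
    exact isCyclic_of_prime_card h2
  · have : Fact (Nat.Prime 3) := ⟨Nat.prime_three⟩
    exact isCyclic_of_prime_card h2

theorem fit_exists {G : Type u1} [Group G] [Finite G] (hG : ¬ Group.IsSolvable G)
    (hc : Nat.card G ≤ 180) : ∃ F : Subgroup G, IsFittingSubgroup F := by
  obtain ⟨F, -, hF⟩ := (Set.toFinite {N : Subgroup G | N.Normal ∧ Group.IsNilpotent N}).exists_le_maximal
    (a := (⊥ : Subgroup G)) ⟨inferInstance, inferInstance⟩
  obtain ⟨⟨hFn, hFnil⟩, hmax⟩ := hF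
  refine ⟨F, hFn, hFnil, fun N hN hNn => ?_⟩
  have hs : Group.IsSolvable (F ⊔ N : Subgroup G) := sol_sup F N inferInstance inferInstance
  have h1 := sol_normal_card hG (F ⊔ N) hs
  have h2 := comm_of_card_le_three (G := (F ⊔ N : Subgroup G)) (by omega)
  have h3 : Group.IsNilpotent (F ⊔ N : Subgroup G) := nilp_of_comm _ (by
    intro a ha b hb
    have := h2.isMulCommutative
    exact congrArg Subtype.val (mul_comm' (⟨a, ha⟩ : (F ⊔ N : Subgroup G)) ⟨b, hb⟩))
  exact le_sup_right.trans (hmax ⟨inferInstance, h3⟩ le_sup_left)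

theorem nilp_nonab {G : Type u1} [Group G] [Finite G] [Group.IsNilpotent G]
    (h : ¬ ∀ a b : G, a * b = b * a) : 4 ≤ (Subgroup.center G).index ∧ 2 ≤ Nat.card (Subgroup.center G) := by
  constructor
  · by_contra hc
    apply h
    have : IsCyclic (G ⧸ Subgroup.center G) := comm_of_card_le_three (by
      rw [← Subgroup.index_eq_card]; omega)
    have := MonoidHom.isMulCommutative_of_isCyclic_of_ker_le_center
      (QuotientGroup.mk' (Subgroup.center G)) (by simp)
    exact fun a b => mul_comm' a b
  · have : Nontrivial G := by
      by_contra hn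
      rw [not_nontrivial_iff_subsingleton] at hn
      exact h fun a b => Subsingleton.elim _ _
    have h1 := Group.IsNilpotent.center_ne_bot (G := G)
    have h2 : Nat.card (Subgroup.center G) ≠ 1 := fun h => h1 (Subgroup.card_eq_one.1 h)
    have h3 : 0 < Nat.card (Subgroup.center G) := Nat.card_pos
    omega

theorem fit_abelian {G : Type u1} [Group G] [Finite G] (hG : ¬ Group.IsSolvable G)
    (hcard : Nat.card G ≤ 720) (F : Subgroup G) (hF : IsFittingSubgroup F)
    (hK : ∀ K : Subgroup G, K.Normal →
      (∀ g : G, ∃ c ∈ Subgroup.centralizer (K : Set G), ∃ k ∈ K, g = c * k) →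
      K ≠ ⊤ → ¬ Group.IsSolvable K → ∀ F' : Subgroup K, IsFittingSubgroup F' → F' = ⊥) :
    ∀ a ∈ F, ∀ b ∈ F, a * b = b * a := by
  obtain ⟨hFn, hFnil, hFmax⟩ := hF
  by_contra hcon
  push Not at hcon
  obtain ⟨x, hx, y, hy, hxy⟩ := hcon
  have hF12 := sol_normal_card hG F inferInstance
  -- F generated by x, y
  have hFab : ¬ ∀ a b : F, a * b = b * a := fun h =>
    hxy (congrArg Subtype.val (h ⟨x, hx⟩ ⟨y, hy⟩))
  obtain ⟨hz1, hz2⟩ := nilp_nonab hFab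
  have hgen : ∀ L : Subgroup G, x ∈ L → y ∈ L → F ≤ L := by
    intro L hxL hyL
    let D : Subgroup F := L.subgroupOf F
    have hDab : ¬ ∀ a b : D, a * b = b * a := fun h =>
      hxy (congrArg (fun z => z.1.1) (h ⟨⟨x, hx⟩, hxL⟩ ⟨⟨y, hy⟩, hyL⟩))
    obtain ⟨d1, d2⟩ := nilp_nonab hDab
    have d3 := Subgroup.card_mul_index (Subgroup.center D)
    have d4 : 8 ≤ Nat.card D := by nlinarith
    have d5 := Subgroup.card_mul_index D
    have d6 : D.index = 1 := by
      have : D.index ≠ 0 := Subgroup.index_ne_zero_of_finite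
      by_contra hne
      have : 2 ≤ D.index := by omega
      nlinarith
    exact Subgroup.subgroupOf_eq_top.1 (Subgroup.index_eq_one.1 d6)
  let K := Subgroup.centralizer (F : Set G)
  have hKn : K.Normal := inferInstance
  have hKF : K.relIndex F = (Subgroup.center F).index := by
    change (K.subgroupOf F).index = _
    congr 1
    ext f
    rw [Subgroup.mem_subgroupOf, Subgroup.mem_center_iff]
    change _ ∈ Subgroup.centralizer (F : Set G) ↔ _
    rw [Subgroup.mem_centralizer_iff]
    constructor
    · intro h g
      exact Subtype.ext (h g g.2)
    · intro h g hg
      exact congrArg Subtype.val (h ⟨g, hg⟩)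
  have hKidx : K.index ≤ 144 := by
    rw [Subgroup.index_eq_card]
    have : Nat.card (F × F) ≤ 144 := by
      rw [Nat.card_prod]
      have : Nat.card F ≤ 12 := by omega
      nlinarith
    refine le_trans ?_ this
    refine Nat.card_le_card_of_injective (fun q : G ⧸ K =>
      ((⟨q.out * x * q.out⁻¹, hFn.conj_mem x hx _⟩ : F),
       (⟨q.out * y * q.out⁻¹, hFn.conj_mem y hy _⟩ : F))) ?_
    intro q r hqr
    have e1 : q.out * x * q.out⁻¹ = r.out * x * r.out⁻¹ := congrArg (fun z => z.1.1) hqr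
    have e2 : q.out * y * q.out⁻¹ = r.out * y * r.out⁻¹ := congrArg (fun z => z.2.1) hqr
    rw [← QuotientGroup.out_eq' q, ← QuotientGroup.out_eq' r, QuotientGroup.eq]
    have h3 : ∀ z, q.out * z * q.out⁻¹ = r.out * z * r.out⁻¹ →
        z ∈ Subgroup.centralizer {q.out⁻¹ * r.out} := by
      intro z hz
      rw [Subgroup.mem_centralizer_singleton_iff]
      have : z = q.out⁻¹ * (r.out * z * r.out⁻¹) * q.out := by rw [← hz]; group
      conv_lhs => rw [this]
      group
    have h4 := hgen _ (h3 x e1) (h3 y e2)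
    change _ ∈ Subgroup.centralizer (F : Set G)
    rw [Subgroup.mem_centralizer_iff]
    intro f hf
    have := h4 hf
    rw [Subgroup.mem_centralizer_singleton_iff] at this
    first | exact this | exact this.symm
  have hrel : K.relIndex (F ⊔ K) = (Subgroup.center F).index := by
    rw [Subgroup.relIndex_sup_right, hKF]
  have hri := Subgroup.relIndex_mul_index (le_sup_right : K ≤ F ⊔ K)
  have hKns : ¬ Group.IsSolvable K := by
    intro hs
    have h1 : Group.IsSolvable (F ⊔ K : Subgroup G) := sol_sup F K inferInstance hs
    have h2 := sol_normal_index hG _ h1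
    nlinarith
  -- card of K
  have hKne : K ≠ ⊤ := by
    intro h
    apply hxy
    have : y ∈ K := h ▸ Subgroup.mem_top y
    exact Subgroup.mem_centralizer_iff.1 this x hx
  let Z : Subgroup K := F.subgroupOf K
  have hZcomm : ∀ a ∈ Z, ∀ b ∈ Z, a * b = b * a := by
    intro a ha b hb
    have h1 : (a : G) ∈ F := ha
    apply Subtype.ext
    exact Subgroup.mem_centralizer_iff.1 b.2 a h1
  have hZn : Z.Normal := inferInstance
  have hZcard : Nat.card Z = Nat.card (Subgroup.center F) := by
    have h1 := Subgroup.card_mul_index (Subgroup.center F)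
    have h2 := Subgroup.card_mul_index (K.subgroupOf F)
    have h3 : (K.subgroupOf F).index = (Subgroup.center F).index := hKF
    have h4 : Nat.card (K.subgroupOf F) = Nat.card Z := by
      have a1 := Nat.card_congr (Subgroup.subgroupOfEquivOfLe (inf_le_right : K ⊓ F ≤ F)).toEquiv
      have a2 := Nat.card_congr (Subgroup.subgroupOfEquivOfLe (inf_le_left : K ⊓ F ≤ K)).toEquiv
      rw [Subgroup.inf_subgroupOf_left] at a2
      rw [Subgroup.inf_subgroupOf_right] at a1
      exact a1.trans a2.symm
    rw [← h4]
    rw [h3, ← h1] at h2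
    exact Nat.eq_of_mul_eq_mul_right (by omega) h2
  have hKcard := sol_normal_card hKns Z (sol_of_comm Z hZcomm)
  have hFc := Subgroup.card_mul_index (Subgroup.center F)
  have hsup : F ⊔ K = ⊤ := by
    rw [← Subgroup.index_eq_one]
    have e1 := Subgroup.card_mul_index K
    have h0 : (F ⊔ K).index ≠ 0 := Subgroup.index_ne_zero_of_finite
    by_contra hne
    have h2 : 2 ≤ (F ⊔ K).index := by omega
    rw [hrel] at hri
    rw [hZcard] at hKcard
    have h3 : 2 * (Subgroup.center F).index ≤ K.index := by nlinarith
    have h5 : 8 ≤ Nat.card (Subgroup.center F) * (Subgroup.center F).index := by nlinarith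
    have h6 : (60 * Nat.card (Subgroup.center F)) * (2 * (Subgroup.center F).index) ≤ Nat.card G := by
      rw [← e1]; exact Nat.mul_le_mul hKcard h3
    nlinarith
  have hK180 : Nat.card K ≤ 180 := by
    rw [hrel, hsup, Subgroup.index_top, mul_one] at hri
    have e1 := Subgroup.card_mul_index K
    rw [← hri] at e1
    nlinarith
  obtain ⟨F', hF'⟩ := fit_exists hKns hK180
  have hbot := hK K hKn (by
    intro g
    have hg : g ∈ ((F ⊔ K : Subgroup G) : Set G) := by rw [hsup]; trivial
    rw [Subgroup.mul_normal] at hg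
    obtain ⟨f, hf, k, hk, rfl⟩ := hg
    refine ⟨f, ?_, k, hk, rfl⟩
    rw [Subgroup.mem_centralizer_iff]
    intro z hz
    exact (Subgroup.mem_centralizer_iff.1 hz f hf).symm) hKne hKns F' hF'
  have hZ : Z ≤ ⊥ := hbot ▸ hF'.2.2 Z hZn (nilp_of_comm Z hZcomm)
  rw [le_bot_iff] at hZ
  rw [hZ, Subgroup.card_bot] at hZcard
  omega

end part4

section part5

theorem mem_pow_card {G : Type u1} [Group G] [Finite G] (H : Subgroup G) {x : G} (hx : x ∈ H) :
    orderOf x ∣ Nat.card H := by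
  have := orderOf_dvd_natCard (⟨x, hx⟩ : H)
  rwa [Subgroup.orderOf_mk] at this

theorem eq_one_of_coprime {G : Type u1} [Group G] {x : G} {a b : ℕ} (ha : orderOf x ∣ a)
    (hb : orderOf x ∣ b) (h : Nat.Coprime a b) : x = 1 := by
  have := Nat.dvd_gcd ha hb
  rw [h] at this
  exact orderOf_eq_one_iff.1 (Nat.dvd_one.1 this)

theorem case_odd {G : Type u1} [Group G] [Finite G] (h : TwC.{u1, u1} G)
    (F : Subgroup G) (hF : IsFittingSubgroup F) (hodd : Nat.Coprime 2 (Nat.card F))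
    (K : Subgroup G) (hK2 : K.index = 2) : False := by
  obtain ⟨hFn, hFnil, hFmax⟩ := hF
  have : Fact (Nat.Prime 2) := ⟨Nat.prime_two⟩
  have hKn : K.Normal := Subgroup.normal_of_index_eq_two hK2
  let P : Sylow 2 G := default
  have hPK : ¬ (P : Subgroup G) ≤ K := by
    intro hle
    have h1 := Subgroup.relIndex_mul_index hle
    have h2 : ¬ 2 ∣ (P : Subgroup G).index := P.not_dvd_index
    rw [hK2] at h1
    exact h2 ⟨_, by rw [← h1, mul_comm]⟩
  obtain ⟨g, hgP, hgK⟩ := Set.not_subset.1 hPK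
  have hcoreP : (P : Subgroup G).normalCore = ⊥ := by
    have h1 : IsPGroup 2 (P : Subgroup G).normalCore := P.2.to_le (Subgroup.normalCore_le _)
    have h2 : (P : Subgroup G).normalCore ≤ F := hFmax _ inferInstance h1.isNilpotent
    rw [eq_bot_iff]
    intro x hx
    obtain ⟨n, hn⟩ := IsPGroup.iff_card.1 h1
    have h3 := mem_pow_card _ hx
    rw [hn] at h3
    have := eq_one_of_coprime h3 (mem_pow_card _ (h2 hx)) (Nat.Coprime.pow_left n hodd)
    simpa using this
  obtain ⟨k, hk1, hk2⟩ := twc_AB h (P : Subgroup G) K (by rw [hcoreP, bot_inf_eq]) g (by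
    intro x y
    by_cases hg : g * (x * g * x⁻¹)⁻¹ ∈ K
    · refine ⟨y⁻¹ * (g * (x * g * x⁻¹)⁻¹) * y, ?_, g, hgP, by group⟩
      have := hKn.conj_mem _ hg y⁻¹
      simpa using this
    · exfalso
      apply hg
      rw [Subgroup.mul_mem_iff_of_index_two hK2]
      constructor
      · intro h; exact absurd h hgK
      · intro h
        exfalso
        apply hgK
        have h1 := K.inv_mem h
        rw [inv_inv] at h1
        have := hKn.conj_mem _ h1 x⁻¹
        simpa [mul_assoc] using this)
  rw [hcoreP, Subgroup.mem_bot, inv_mul_eq_one] at hk2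
  exact hgK (hk2 ▸ Subgroup.normalCore_le _ hk1)

theorem case_even_aux {G : Type u1} [Group G] (x y t1 t2 k1 k2 : G)
    (he : (y * t1 * y⁻¹ : G) * (x * k1 * x⁻¹) = (y * t2 * y⁻¹) * (x * k2 * x⁻¹)) :
    (t2⁻¹ * t1 : G) = (y⁻¹ * x) * (k2 * k1⁻¹) * (y⁻¹ * x)⁻¹ := by
  have h1 : t1 = y⁻¹ * ((y * t2 * y⁻¹) * (x * k2 * x⁻¹)) * (x * k1 * x⁻¹)⁻¹ * y := by
    rw [← he]; simp only [mul_inv_rev, inv_inv, mul_assoc, inv_mul_cancel_left, mul_inv_cancel_left, inv_mul_cancel, mul_one]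
  rw [h1]
  simp only [mul_inv_rev, inv_inv, mul_assoc, inv_mul_cancel_left, mul_inv_cancel_left, inv_mul_cancel, mul_one]

theorem case_even {G : Type u1} [Group G] [Finite G] (h : TwC.{u1, u1} G)
    (F : Subgroup G) (hF : IsFittingSubgroup F) (h5 : Nat.Coprime 5 (Nat.card F))
    (K : Subgroup G) (hKnn : K.Normal) (hFK : F ≤ K) (hKF : Nat.card K = 60 * Nat.card F)
    (hKns : ¬ Group.IsSolvable K) : False := by
  obtain ⟨hFn, hFnil, hFmax⟩ := hF
  have hFpos : 0 < Nat.card F := Nat.card_pos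
  have : Fact (Nat.Prime 5) := ⟨by norm_num⟩
  let Z : Subgroup K := F.subgroupOf K
  have hZc : Nat.card Z = Nat.card F := Nat.card_congr (Subgroup.subgroupOfEquivOfLe hFK).toEquiv
  have hZi : Z.index = 60 := by
    have := Subgroup.card_mul_index Z
    rw [hZc, hKF, mul_comm] at this
    exact Nat.eq_of_mul_eq_mul_right hFpos this
  have hZs : Group.IsSolvable Z :=
    Group.isSolvable_of_isSolvable_injective (f := (Subgroup.subgroupOfEquivOfLe hFK).toMonoidHom)
      (Subgroup.subgroupOfEquivOfLe hFK).injective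
  have hQ : ¬ Group.IsSolvable (K ⧸ Z) := fun hq =>
    hKns ((Group.isSolvable_iff_subgroup_quotient Z).2 ⟨hZs, hq⟩)
  obtain ⟨-, L, hL⟩ := small_insoluble 60 (K ⧸ Z) (by rw [← Subgroup.index_eq_card, hZi]) (by norm_num) hQ
  let L' : Subgroup K := L.comap (QuotientGroup.mk' Z)
  have hL' : L'.index = 5 := by
    rw [← hL]; exact Subgroup.index_comap_of_surjective _ (QuotientGroup.mk'_surjective Z)
  let H0 : Subgroup G := L'.map K.subtype
  have hH0K : H0 ≤ K := Subgroup.map_subtype_le L'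
  have hH0c : Nat.card H0 = 12 * Nat.card F := by
    have h1 : Nat.card H0 = Nat.card L' :=
      (Nat.card_congr (L'.equivMapOfInjective K.subtype K.subtype_injective).toEquiv).symm
    have h2 := Subgroup.card_mul_index L'
    rw [hL', hKF] at h2
    omega
  obtain ⟨t, ht⟩ := exists_prime_orderOf_dvd_card' (G := K) 5 (by rw [hKF]; exact ⟨12 * Nat.card F, by ring⟩)
  let T : Subgroup G := Subgroup.zpowers (t : G)
  have hTc : Nat.card T = 5 := by
    rw [Nat.card_zpowers, Subgroup.orderOf_coe, ht]
  have hTK : T ≤ K := Subgroup.zpowers_le.2 t.2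
  have hcop : Nat.Coprime 5 (Nat.card H0) := by
    rw [hH0c]; exact Nat.Coprime.mul_right (by norm_num) h5
  have hcoreT : T.normalCore = ⊥ := by
    have h1 : IsPGroup 5 T := IsPGroup.of_card (n := 1) (by rw [hTc, pow_one])
    have h1' : IsPGroup 5 T.normalCore := h1.to_le (Subgroup.normalCore_le _)
    have h2 : T.normalCore ≤ F := hFmax _ inferInstance h1'.isNilpotent
    rw [eq_bot_iff]
    intro x hx
    have h3 := mem_pow_card _ (Subgroup.normalCore_le _ hx)
    rw [hTc] at h3
    have := eq_one_of_coprime h3 (mem_pow_card _ (h2 hx)) h5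
    simpa using this
  have hle : K ≤ H0 := by
    intro a ha
    obtain ⟨g, hg1, hg2⟩ := twc_AB h H0 T (by rw [hcoreT, inf_bot_eq]) a⁻¹ (by
      intro x y
      let f : T × H0 → K := fun p => ⟨(y * p.1 * y⁻¹) * (x * p.2 * x⁻¹),
        K.mul_mem (hKnn.conj_mem _ (hTK p.1.2) y) (hKnn.conj_mem _ (hH0K p.2.2) x)⟩
      have hf : Function.Injective f := by
        rintro ⟨t1, k1⟩ ⟨t2, k2⟩ he
        have he : (y * t1 * y⁻¹ : G) * (x * k1 * x⁻¹) = (y * t2 * y⁻¹) * (x * k2 * x⁻¹) :=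
          congrArg Subtype.val he
        have h1 : (t2⁻¹ * t1 : G) = (y⁻¹ * x) * (k2 * k1⁻¹) * (y⁻¹ * x)⁻¹ := by
          exact case_even_aux _ _ _ _ _ _ he
        have h2 : (t2⁻¹ * t1 : G) = 1 := by
          apply eq_one_of_coprime (a := 5) (b := Nat.card H0) _ _ hcop
          · rw [← hTc]; exact mem_pow_card T (T.mul_mem (T.inv_mem t2.2) t1.2)
          · rw [h1]
            have h3 := mem_pow_card H0 (H0.mul_mem k2.2 (H0.inv_mem k1.2))
            rwa [← orderOf_injective (MulAut.conj (y⁻¹ * x)).toMonoidHom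
              (MulAut.conj (y⁻¹ * x)).injective] at h3
        have h3 : t2 = t1 := Subtype.ext (inv_mul_eq_one.1 h2)
        subst h3
        have h4 : k1 = k2 := by
          apply Subtype.ext
          have := mul_left_cancel he
          simpa using this
        rw [h4]
      have hb : Function.Bijective f := by
        rw [Nat.bijective_iff_injective_and_card]
        refine ⟨hf, ?_⟩
        rw [Nat.card_prod, hTc, hH0c, hKF]; ring
      obtain ⟨⟨t1, k1⟩, he⟩ := hb.2 ⟨a⁻¹, K.inv_mem ha⟩
      exact ⟨t1, t1.2, k1, k1.2, (congrArg Subtype.val he).symm⟩)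
    rw [hcoreT, Subgroup.mem_bot] at hg1
    rw [hg1, inv_inv, mul_one] at hg2
    exact Subgroup.normalCore_le _ hg2
  have := Subgroup.card_le_of_le hle
  omega

end part5

section part7

theorem fit_arith (n i : ℕ) (hn2 : 2 ≤ n) (hKi : i ∣ Nat.totient n) (key : i * n ≤ 12)
    (hi2 : 2 ≤ i) (hn6 : n ≤ 6) : i = 2 ∧ (n = 3 ∨ n = 5 ∨ n = 4 ∨ n = 6) := by
  have hle := Nat.le_of_dvd (Nat.totient_pos.2 (by omega)) hKi
  have t2 : Nat.totient 2 = 1 := by decide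
  have t3 : Nat.totient 3 = 2 := by decide
  have t4 : Nat.totient 4 = 2 := by decide
  have t5 : Nat.totient 5 = 4 := by decide
  have t6 : Nat.totient 6 = 2 := by decide
  interval_cases n
  · omega
  · omega
  · omega
  · omega
  · omega

theorem fit_central {G : Type u1} [Group G] [Finite G] (hG : ¬ Group.IsSolvable G)
    (h : TwC.{u1, u1} G) (hcard : Nat.card G ≤ 720) (F : Subgroup G) (hF : IsFittingSubgroup F)
    (hFnt : F ≠ ⊥) (hab : ∀ a ∈ F, ∀ b ∈ F, a * b = b * a) : F = Subgroup.center G := by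
  have hF' := hF
  obtain ⟨hFn, hFnil, hFmax⟩ := hF
  have hcyc : IsCyclic F := abel_cyclic h F hab
  have hn2 : 2 ≤ Nat.card F := by
    have h1 : Nat.card F ≠ 1 := fun h1 => hFnt ((Subgroup.card_eq_one).1 h1)
    have h2 : 0 < Nat.card F := Nat.card_pos
    omega
  let f : G →* (ZMod (Nat.card F))ˣ :=
    (IsCyclic.mulAutMulEquiv F).toMonoidHom.comp MulAut.conjNormal
  have hker : ∀ g : G, g ∈ f.ker ↔ ∀ x ∈ F, g * x = x * g := by
    intro g
    have h1 : g ∈ f.ker ↔ (MulAut.conjNormal g : MulAut F) = 1 := by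
      rw [MonoidHom.mem_ker]
      change (IsCyclic.mulAutMulEquiv F) (MulAut.conjNormal g) = 1 ↔ _
      simp
    rw [h1]
    constructor
    · intro h2 x hx
      have h3 := MulAut.conjNormal_apply (H := F) g ⟨x, hx⟩
      rw [h2] at h3
      have h3 : x = g * x * g⁻¹ := h3
      exact (mul_inv_eq_iff_eq_mul.1 h3.symm)
    · intro h2
      ext x
      rw [MulAut.conjNormal_apply, h2 x x.2]
      simp
  set K : Subgroup G := f.ker with hK
  have hFK : F ≤ K := fun x hx => (hker x).2 (fun y hy => hab x hx y hy)
  have hKi : K.index ∣ Nat.totient (Nat.card F) := by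
    have : NeZero (Nat.card F) := ⟨by omega⟩
    rw [hK, Subgroup.index_ker, ← ZMod.card_units_eq_totient, ← Nat.card_eq_fintype_card]
    exact Subgroup.card_subgroup_dvd_card _
  have hKns : ¬ Group.IsSolvable K := by
    intro hs
    apply hG
    exact Group.isSolvable_of_ker_le_range K.subtype f (by rw [Subgroup.range_subtype])
  let Z : Subgroup K := F.subgroupOf K
  have hZc : Nat.card Z = Nat.card F := Nat.card_congr (Subgroup.subgroupOfEquivOfLe hFK).toEquiv
  have hZs : Group.IsSolvable Z :=
    Group.isSolvable_of_isSolvable_injective (f := (Subgroup.subgroupOfEquivOfLe hFK).toMonoidHom)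
      (Subgroup.subgroupOfEquivOfLe hFK).injective
  have h60 := sol_normal_card hKns Z hZs
  rw [hZc] at h60
  have hKc := Subgroup.card_mul_index K
  have hi0 : K.index ≠ 0 := Subgroup.FiniteIndex.index_ne_zero
  have key : K.index * Nat.card F ≤ 12 := by
    have : 60 * (K.index * Nat.card F) ≤ 720 := by
      calc 60 * (K.index * Nat.card F) = (60 * Nat.card F) * K.index := by ring
        _ ≤ Nat.card K * K.index := Nat.mul_le_mul_right _ h60
        _ ≤ 720 := by omega
    omega
  have hi1 : K.index = 1 := by
    by_contra hi1
    have hi2 : 2 ≤ K.index := by omega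
    have hn6 : Nat.card F ≤ 6 := by
      by_contra hc
      have : 2 * 7 ≤ K.index * Nat.card F := Nat.mul_le_mul hi2 (by omega)
      omega
    have hcase : K.index = 2 ∧ (Nat.card F = 3 ∨ Nat.card F = 5 ∨ Nat.card F = 4 ∨ Nat.card F = 6) := by
      exact fit_arith _ _ hn2 hKi key hi2 hn6
    obtain ⟨hk2, hc⟩ := hcase
    have hev : (Nat.card F = 4 ∨ Nat.card F = 6) → False := by
      intro hc
      have hcardQ : Nat.card (K ⧸ Z) * Nat.card F = Nat.card K := by
        rw [← hZc, ← Subgroup.index_eq_card, mul_comm, Subgroup.card_mul_index]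
      have hQns : ¬ Group.IsSolvable (K ⧸ Z) := fun hq =>
        hKns ((Group.isSolvable_iff_subgroup_quotient Z).2 ⟨hZs, hq⟩)
      have h90 : Nat.card (K ⧸ Z) ≤ 90 := by
        rw [hk2] at hKc
        rcases hc with hc | hc <;> rw [hc] at hcardQ <;> omega
      have h60 := (small_insoluble _ (K ⧸ Z) rfl h90 hQns).1
      rw [h60] at hcardQ
      refine case_even h F hF' ?_ K inferInstance hFK hcardQ.symm hKns
      rcases hc with hc | hc <;> rw [hc] <;> norm_num
    rcases hc with hc | hc | hc
    · exact case_odd h F hF' (by rw [hc]; norm_num) K hk2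
    · exact case_odd h F hF' (by rw [hc]; norm_num) K hk2
    · exact hev hc
  have hKt : K = ⊤ := Subgroup.index_eq_one.1 hi1
  apply le_antisymm
  · intro x hx
    rw [Subgroup.mem_center_iff]
    intro g
    exact (hker g).1 (by rw [hKt]; trivial) x hx
  · exact hFmax _ inferInstance (nilp_of_comm _ (fun a ha b hb => (Subgroup.mem_center_iff.1 hb a)))

theorem min_nonab {G : Type u1} [Group G] [Finite G] 
    (hF : IsFittingSubgroup (Subgroup.center G)) (M : Subgroup (G ⧸ Subgroup.center G))
    (hM : IsMinimalNormal M) : ¬ ∀ x ∈ M, ∀ y ∈ M, x * y = y * x := by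
  intro hab
  obtain ⟨hMn, hMb, hMm⟩ := hM
  obtain ⟨hFn, hFnil, hFmax⟩ := hF
  let π := QuotientGroup.mk' (Subgroup.center G)
  let N := M.comap π
  have hNn : N.Normal := inferInstance
  have hMnil : Group.IsNilpotent M := nilp_of_comm M hab
  let f : N →* M := (π.comp N.subtype).codRestrict M (fun x => x.2)
  have hNnil : Group.IsNilpotent N := by
    refine Subgroup.isNilpotent_of_ker_le_center f ?_
    intro x hx
    rw [MonoidHom.mem_ker] at hx
    have h1 : π (x : G) = 1 := congrArg Subtype.val hx
    have h2 : (x : G) ∈ Subgroup.center G := (QuotientGroup.eq_one_iff _).1 h1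
    rw [Subgroup.mem_center_iff] at h2 ⊢
    intro g
    exact Subtype.ext (h2 g)
  have hle := hFmax N hNn hNnil
  apply hMb
  rw [eq_bot_iff]
  intro m hm
  obtain ⟨g, rfl⟩ := QuotientGroup.mk'_surjective (Subgroup.center G) m
  have : g ∈ Subgroup.center G := hle hm
  rw [Subgroup.mem_bot]
  exact (QuotientGroup.eq_one_iff _).2 this

theorem min_insol {Q : Type u1} [Group Q] [Finite Q] (M : Subgroup Q)
    (hM : IsMinimalNormal M) (hab : ¬ ∀ x ∈ M, ∀ y ∈ M, x * y = y * x) : 60 ≤ Nat.card M := by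
  obtain ⟨hMn, hMb, hMm⟩ := hM
  apply insol_card
  intro hs
  rcases hMm ⁅M, M⁆ inferInstance (Subgroup.commutator_le_left M M) with h | h
  · apply hab
    intro x hx y hy
    have := Subgroup.commutator_mem_commutator hx hy
    rw [h, Subgroup.mem_bot, commutatorElement_eq_one_iff_mul_comm] at this
    exact this
  · have hc : ⁅(⊤ : Subgroup M), (⊤ : Subgroup M)⁆ = ⊤ := by
      apply Subgroup.map_injective M.subtype_injective
      rw [Subgroup.map_commutator, ← MonoidHom.range_eq_map, Subgroup.range_subtype, h]
    have hd : ∀ n, derivedSeries M n = ⊤ := by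
      intro n
      induction n with
      | zero => rfl
      | succ n ih => rw [derivedSeries_succ, ih, hc]
    obtain ⟨n, hn⟩ := (Group.isSolvable_def M).1 hs
    rw [hd] at hn
    apply hMb
    rw [← Subgroup.range_subtype M, MonoidHom.range_eq_map, hn, Subgroup.map_bot]

theorem main720 {G : Type u1} [Group G] [Finite G] (hG : ¬ Group.IsSolvable G)
    (h : TwC.{u1, u1} G) (hcard : Nat.card G ≤ 720) (F : Subgroup G) (hF : IsFittingSubgroup F)
    (hFnt : F ≠ ⊥) (hab : ∀ a ∈ F, ∀ b ∈ F, a * b = b * a) : 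
    F = Subgroup.center G ∧ IsCyclic (Subgroup.center G) ∧
    ∃ M : Subgroup (G ⧸ Subgroup.center G), IsMinimalNormal M ∧
      (¬ ∀ x ∈ M, ∀ y ∈ M, x * y = y * x) ∧
      ∀ M' : Subgroup (G ⧸ Subgroup.center G), IsMinimalNormal M' → M' = M := by
  have hFc := fit_central hG h hcard F hF hFnt hab
  subst hFc
  refine ⟨rfl, abel_cyclic h _ hab, ?_⟩
  have hn2 : 2 ≤ Nat.card (Subgroup.center G) := by
    have h1 : Nat.card (Subgroup.center G) ≠ 1 := fun h1 => hFnt ((Subgroup.card_eq_one).1 h1)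
    have h2 : 0 < Nat.card (Subgroup.center G) := Nat.card_pos
    omega
  have hQ : Nat.card (G ⧸ Subgroup.center G) ≤ 360 := by
    have := Subgroup.card_mul_index (Subgroup.center G)
    rw [Subgroup.index_eq_card] at this
    have h2 := Nat.mul_le_mul_right (Nat.card (G ⧸ Subgroup.center G)) hn2
    omega
  have hQ60 := sol_normal_index hG (Subgroup.center G) (sol_of_comm _ hab)
  rw [Subgroup.index_eq_card] at hQ60
  have hnt : (⊤ : Subgroup (G ⧸ Subgroup.center G)) ≠ ⊥ := by
    intro ht
    have h1 : Nat.card (⊤ : Subgroup (G ⧸ Subgroup.center G)) = 1 := by rw [ht]; simp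
    rw [Subgroup.card_top] at h1
    omega
  obtain ⟨M, -, hM⟩ := (Set.toFinite {N : Subgroup (G ⧸ Subgroup.center G) | N.Normal ∧ N ≠ ⊥}).exists_le_minimal
    (a := ⊤) ⟨inferInstance, hnt⟩
  have hMmin : IsMinimalNormal M := by
    refine ⟨hM.1.1, hM.1.2, fun N hN hle => ?_⟩
    by_cases hb : N = ⊥
    · exact Or.inl hb
    · exact Or.inr (le_antisymm hle (hM.2 ⟨hN, hb⟩ hle))
  have hMna := min_nonab hF M hMmin
  refine ⟨M, hMmin, hMna, fun M' hM' => ?_⟩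
  by_contra hne
  have h1 := min_insol M hMmin hMna
  have h2 := min_insol M' hM' (min_nonab hF M' hM')
  have := hMmin.1
  have := hM'.1
  have hinf : M ⊓ M' = ⊥ := by
    rcases hMmin.2.2 (M ⊓ M') inferInstance inf_le_left with h3 | h3
    · exact h3
    · rcases hM'.2.2 (M ⊓ M') inferInstance inf_le_right with h4 | h4
      · exact h4
      · exact absurd (h4.symm.trans h3) hne
  have hinj : Function.Injective (fun p : M × M' => (p.1 * p.2 : G ⧸ Subgroup.center G)) := by
    exact Subgroup.mul_injective_of_disjoint (disjoint_iff.2 hinf)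
  have h3 := Nat.card_le_card_of_injective _ hinj
  rw [Nat.card_prod] at h3
  have h4 := Nat.mul_le_mul h1 h2
  omega

end part7

section part8
open scoped Pointwise

theorem sylow_trans {S : Type u1} [Group S] [Finite S] (p : ℕ) [Fact p.Prime]
    (hTI : ∀ P Q : Sylow p S, ∀ x : S, x ≠ 1 → x ∈ P → x ∈ Q → P = Q) (M : Subgroup S)
    (hM : ∀ P : Sylow p S, ∃ x ∈ P, x ∈ M ∧ x ≠ 1) : Nat.card (Sylow p S) ∣ Nat.card M := by
  let P0 : Sylow p S := default
  have hp : p.Prime := Fact.out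
  have hW : ∀ Q : Sylow p S, IsPGroup p ((Q : Subgroup S).subgroupOf M) := fun Q =>
    Q.2.comap_of_injective M.subtype M.subtype_injective
  have hfix : ∀ Q : Sylow p S, ∀ R : MulAction.orbit M P0,
      R ∈ MulAction.fixedPoints ((Q : Subgroup S).subgroupOf M) (MulAction.orbit M P0) ↔ R.1 = Q := by
    intro Q R
    constructor
    · intro h
      have h1 : R.1 ∈ MulAction.fixedPoints (Q ⊓ M : Subgroup S) (Sylow p S) := by
        rintro ⟨w, hw1, hw2⟩
        exact congrArg Subtype.val (h ⟨⟨w, hw2⟩, hw1⟩)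
      rw [IsPGroup.sylow_mem_fixedPoints_iff (Q.2.to_le inf_le_left)] at h1
      obtain ⟨x, hx1, hx2, hx3⟩ := hM Q
      exact hTI _ _ x hx3 (h1 ⟨hx1, hx2⟩) hx1
    · intro h w
      apply Subtype.ext
      change (w : M) • (R.1) = R.1
      rw [h]
      change ((w : M) : S) • Q = Q
      rw [Sylow.smul_eq_iff_mem_normalizer]
      exact Subgroup.le_normalizer w.2
  have h1 : ¬ p ∣ Nat.card (MulAction.orbit M P0) := by
    have h2 := (hW P0).card_modEq_card_fixedPoints (MulAction.orbit M P0)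
    have h3 : Nat.card (MulAction.fixedPoints ((P0 : Subgroup S).subgroupOf M) (MulAction.orbit M P0)) = 1 := by
      rw [Nat.card_eq_one_iff_unique]
      refine ⟨⟨fun a b => ?_⟩, ⟨⟨⟨P0, MulAction.mem_orbit_self _⟩, (hfix P0 _).2 rfl⟩⟩⟩
      exact Subtype.ext (Subtype.ext (((hfix P0 _).1 a.2).trans ((hfix P0 _).1 b.2).symm))
    rw [h3] at h2
    intro hd
    have h4 := (Nat.modEq_zero_iff_dvd.2 hd).symm.trans h2
    have := (Nat.modEq_zero_iff_dvd.1 h4.symm)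
    exact hp.one_lt.ne' (Nat.dvd_one.1 this)
  have h2 : ∀ Q : Sylow p S, Q ∈ MulAction.orbit M P0 := by
    intro Q
    obtain ⟨R, hR⟩ := (hW Q).nonempty_fixed_point_of_prime_not_dvd_card _ h1
    rw [← (hfix Q R).1 hR]
    exact R.2
  have h3 : Nat.card (Sylow p S) = Nat.card (MulAction.orbit M P0) :=
    (Nat.card_congr (Equiv.subtypeUnivEquiv h2)).symm
  rw [h3, Nat.card_congr (MulAction.orbitEquivQuotientStabilizer M P0)]
  exact Subgroup.card_quotient_dvd_card _

theorem inter_exists {S : Type u1} [Group S] [Finite S] (p : ℕ) [Fact p.Prime] (H : Subgroup S) :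
    ∃ M : Subgroup S, ∀ m, m ∈ M ↔ ∀ P : Sylow p S, ∃ u ∈ P, ∃ h ∈ H, m = u * h := by
  let M0 : Submonoid S :=
    { carrier := {m | ∀ P : Sylow p S, ∃ u ∈ P, ∃ h ∈ H, m = u * h}
      one_mem' := fun P => ⟨1, one_mem _, 1, one_mem _, by simp⟩
      mul_mem' := by
        intro m1 m2 h1 h2 P
        obtain ⟨u, hu, h, hh, rfl⟩ := h1 P
        obtain ⟨u', hu', h', hh', rfl⟩ := h2 (h⁻¹ • P)
        refine ⟨u * (h * u' * h⁻¹), mul_mem hu ?_, h * h', mul_mem hh hh', by group⟩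
        have : u' ∈ MulAut.conj h⁻¹ • (P : Subgroup S) := hu'
        rw [Subgroup.mem_pointwise_smul_iff_inv_smul_mem] at this
        have h3 : h * u' * h⁻¹ ∈ (P : Subgroup S) := by simpa using this
        exact h3 }
  refine ⟨{ M0 with inv_mem' := ?_ }, fun m => Iff.rfl⟩
  intro x hx
  have h1 : x⁻¹ = x ^ (orderOf x - 1) := by
    rw [inv_eq_iff_mul_eq_one, ← pow_succ', Nat.sub_add_cancel (orderOf_pos x), pow_orderOf_eq_one]
  rw [h1]
  exact M0.pow_mem hx _

theorem inter_le {S : Type u1} [Group S] [Finite S] (p : ℕ) [Fact p.Prime] (H M : Subgroup S)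
    (hM : ∀ m, m ∈ M ↔ ∀ P : Sylow p S, ∃ u ∈ P, ∃ h ∈ H, m = u * h) : H ≤ M :=
  fun h hh => (hM h).2 fun P => ⟨1, one_mem _, h, hh, by simp⟩

theorem inter_index {S : Type u1} [Group S] [Finite S] (p : ℕ) [Fact p.Prime] (H M : Subgroup S)
    (hM : ∀ m, m ∈ M ↔ ∀ P : Sylow p S, ∃ u ∈ P, ∃ h ∈ H, m = u * h) (P : Sylow p S) :
    H.relIndex M ∣ Nat.card (P ⊓ M : Subgroup S) := by
  let W : Subgroup M := (P : Subgroup S).subgroupOf M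
  have hW : Nat.card W = Nat.card (P ⊓ M : Subgroup S) := by
    have : (P ⊓ M : Subgroup S).subgroupOf M = W := Subgroup.inf_subgroupOf_right _ _
    rw [← this]
    exact Nat.card_congr (Subgroup.subgroupOfEquivOfLe inf_le_right).toEquiv
  rw [← hW, Subgroup.relIndex]
  let H' := H.subgroupOf M
  have hHM := inter_le p H M hM
  have key : ∀ m : M, ∃ w ∈ W, (m : M ⧸ H') = w • ((1 : M) : M ⧸ H') := by
    intro m
    obtain ⟨u, hu, h, hh, he⟩ := (hM m).1 m.2 P
    have huM : u ∈ M := by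
      have : u = m * h⁻¹ := by rw [he]; simp
      rw [this]; exact mul_mem m.2 (inv_mem (hHM hh))
    refine ⟨⟨u, huM⟩, hu, ?_⟩
    rw [MulAction.Quotient.smul_coe, smul_eq_mul, mul_one]
    apply Eq.symm
    rw [QuotientGroup.eq]
    change u⁻¹ * (m : S) ∈ H
    rw [he]; simpa using hh
  have htr : MulAction.IsPretransitive W (M ⧸ H') := by
    rw [MulAction.isPretransitive_iff_base ((1 : M) : M ⧸ H')]
    intro x
    obtain ⟨m, rfl⟩ := QuotientGroup.mk_surjective x
    obtain ⟨w, hw, he⟩ := key m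
    exact ⟨⟨w, hw⟩, he.symm⟩
  change H'.index ∣ _
  rw [Subgroup.index_eq_card, ← MulAction.index_stabilizer_of_transitive W ((1 : M) : M ⧸ H')]
  exact Subgroup.index_dvd_card _

theorem inter_ne {S : Type u1} [Group S] [Finite S] (p : ℕ) [Fact p.Prime] (H M : Subgroup S)
    (hM : ∀ m, m ∈ M ↔ ∀ P : Sylow p S, ∃ u ∈ P, ∃ h ∈ H, m = u * h) (hne : ¬ M ≤ H) (P : Sylow p S) :
    ∃ x ∈ P, x ∈ M ∧ x ≠ 1 := by
  have h1 := inter_index p H M hM P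
  by_contra hc
  have h2 : (P ⊓ M : Subgroup S) = ⊥ := by
    rw [eq_bot_iff]
    intro x hx
    by_contra hx1
    exact hc ⟨x, hx.1, hx.2, hx1⟩
  rw [h2, Subgroup.card_bot, Nat.dvd_one, Subgroup.relIndex_eq_one] at h1
  exact hne h1

end part8

section part9
open scoped Pointwise

structure SLData (S : Type u1) (X : Type v1) [Group S] [MulAction S X] (z : S) : Prop where
  card : Nat.card S = 720
  z2 : z * z = 1
  zne : z ≠ 1
  inv : ∀ x : S, x * x = 1 → x = 1 ∨ x = z
  ne : Nonempty X
  stab : ∀ v : X, Nat.card (MulAction.stabilizer S v) = 9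
  trans : MulAction.IsPretransitive S X
  fixc : ∀ g : S, g ≠ 1 → ∀ v : X, g • v = v → Nat.card {w : X // g • w = w} = 8
  fixs : ∀ g : S, g ≠ 1 → ∀ v w : X, g • v = v → g • w = w →
    MulAction.stabilizer S w = MulAction.stabilizer S v
  rigid : ∀ θ : X → X, (∀ v w, ∃ g : S, θ v = g • v ∧ θ w = g • w) → ∃ g : S, ∀ v, θ v = g • v

namespace SLData

instance fact3 : Fact (Nat.Prime 3) := ⟨by norm_num⟩
instance fact5 : Fact (Nat.Prime 5) := ⟨by norm_num⟩

variable {S : Type u1} {X : Type v1} [Group S] [MulAction S X] {z : S} (D : SLData S X z)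
include D

theorem fin : Finite S := Nat.finite_of_card_ne_zero (by rw [D.card]; norm_num)

theorem zmem {Y : Subgroup S} (h : 2 ∣ Nat.card Y) : z ∈ Y := by
  have := D.fin
  have : Fact (Nat.Prime 2) := ⟨Nat.prime_two⟩
  obtain ⟨x, hx⟩ := exists_prime_orderOf_dvd_card' (G := Y) 2 h
  have h1 : (x : S) * x = 1 := by
    have := pow_orderOf_eq_one x
    rw [hx, pow_two] at this
    exact congrArg Subtype.val this
  rcases D.inv x h1 with h2 | h2
  · have : x = 1 := Subtype.ext h2
    rw [this] at hx
    simp at hx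
  · rw [← h2]; exact x.2

theorem zcent (g : S) : g * z = z * g := by
  have h1 : (g * z * g⁻¹) * (g * z * g⁻¹) = 1 := by
    have : (g * z * g⁻¹) * (g * z * g⁻¹) = g * (z * z) * g⁻¹ := by group
    rw [this, D.z2]; group
  rcases D.inv _ h1 with h2 | h2
  · exfalso; apply D.zne
    have : g * z = g := by
      have := congrArg (· * g) h2
      simpa using this
    simpa using this
  · have := congrArg (· * g) h2
    simpa using this

theorem zeven {Y : Subgroup S} (h : z ∈ Y) : 2 ∣ Nat.card Y := by
  have := D.fin
  have h1 := mem_pow_card Y h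
  have : Fact (Nat.Prime 2) := ⟨Nat.prime_two⟩
  rwa [orderOf_eq_prime (by rw [pow_two]; exact D.z2) D.zne] at h1

theorem syl3 (P : Sylow 3 S) : ∃ v : X, (P : Subgroup S) = MulAction.stabilizer S v := by
  have := D.fin
  obtain ⟨v⟩ := D.ne
  let Q : Sylow 3 S := Sylow.ofCard (MulAction.stabilizer S v) (by
    rw [D.stab, D.card]
    have h : Nat.factorization 720 3 = 2 := by
      rw [Nat.factorization_def _ (by norm_num)]
      have : (720 : ℕ) = 3 ^ 2 * 80 := by norm_num
      rw [this, padicValNat_base_pow_mul (by norm_num) (by norm_num),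
        padicValNat.eq_zero_of_not_dvd (by norm_num)]
    rw [h]; norm_num)
  obtain ⟨g, hg⟩ := MulAction.exists_smul_eq S Q P
  refine ⟨g • v, ?_⟩
  rw [← hg, MulAction.stabilizer_smul_eq_stabilizer_map_conj]
  rfl

theorem le3 {T : Subgroup S} (hT : IsPGroup 3 T) : ∃ v : X, T ≤ MulAction.stabilizer S v := by
  obtain ⟨Q, hQ⟩ := hT.exists_le_sylow
  obtain ⟨v, hv⟩ := D.syl3 Q
  exact ⟨v, hv ▸ hQ⟩

theorem TI3 (P Q : Sylow 3 S) (x : S) (hx : x ≠ 1) (hP : x ∈ P) (hQ : x ∈ Q) : P = Q := by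
  obtain ⟨v, hv⟩ := D.syl3 P
  obtain ⟨w, hw⟩ := D.syl3 Q
  have h1 : x ∈ MulAction.stabilizer S v := hv ▸ hP
  have h2 : x ∈ MulAction.stabilizer S w := hw ▸ hQ
  apply Sylow.ext
  rw [hv, hw]
  exact D.fixs x hx w v h2 h1

theorem no35 (T B : Subgroup S) (hT : IsPGroup 3 T) (hT1 : T ≠ ⊥) (hB : Nat.card B = 5)
    (hBT : ∀ b ∈ B, ∀ t ∈ T, b * t * b⁻¹ ∈ T) : False := by
  have := D.fin
  obtain ⟨v, hv⟩ := D.le3 hT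
  obtain ⟨t, ht, ht1⟩ := exists_ne_one_of_ne_bot hT1
  let Y : SubMulAction B X :=
    { carrier := {w | T ≤ MulAction.stabilizer S w}
      smul_mem' := by
        intro b w hw s hs
        have h1 := hBT b⁻¹ (inv_mem b.2) s hs
        have h2 : ((b : S)⁻¹ * s * (b : S)⁻¹⁻¹) • w = w := hw h1
        change s • ((b : S) • w) = (b : S) • w
        rw [inv_inv, mul_smul, mul_smul, inv_smul_eq_iff] at h2
        exact h2 }
  have hc : Nat.card Y = 8 := by
    rw [← D.fixc t ht1 v (hv ht)]
    apply Nat.card_congr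
    refine Equiv.subtypeEquivRight fun w => ?_
    constructor
    · intro hw; exact hw ht
    · intro hw
      change T ≤ _
      rw [D.fixs t ht1 v w (hv ht) hw]
      exact hv
  have hB5 : IsPGroup 5 B := IsPGroup.of_card (n := 1) (by rw [hB, pow_one])
  obtain ⟨w, hw⟩ := hB5.nonempty_fixed_point_of_prime_not_dvd_card Y (by rw [hc]; norm_num)
  have h1 : B ≤ MulAction.stabilizer S (w : X) := fun b hb => congrArg Subtype.val (hw ⟨b, hb⟩)
  have h2 := Subgroup.card_dvd_of_le h1
  rw [hB, D.stab] at h2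
  norm_num at h2

theorem n3 : 5 ∣ Nat.card (Sylow 3 S) := by
  have := D.fin
  let P : Sylow 3 S := default
  have h1 := P.card_eq_index_normalizer
  have h2 := Subgroup.card_mul_index (Subgroup.normalizer (P : Set S))
  rw [← h1, D.card] at h2
  by_contra hc
  have h3 : 5 ∣ Nat.card (Subgroup.normalizer (P : Set S)) :=
    ((Nat.Prime.dvd_mul (by norm_num)).1 (h2 ▸ (by norm_num : 5 ∣ 720))).resolve_right hc
  obtain ⟨b, hb⟩ := exists_prime_orderOf_dvd_card' 5 h3
  refine D.no35 P (Subgroup.zpowers (b : S)) P.2 ?_ ?_ ?_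
  · intro hbot
    obtain ⟨v, hv⟩ := D.syl3 P
    have := D.stab v
    rw [← hv, hbot] at this
    simp at this
  · rw [Nat.card_zpowers, Subgroup.orderOf_coe, hb]
  · intro x hx t ht
    have h4 : x ∈ Subgroup.normalizer (P : Set S) := (Subgroup.zpowers_le.2 b.2) hx
    exact (Subgroup.mem_normalizer_iff.1 h4 t).1 ht

theorem card5 (P : Sylow 5 S) : Nat.card P = 5 := by
  have := D.fin
  have h := P.card_eq_multiplicity
  rw [D.card] at h
  have h1 : Nat.factorization 720 5 = 1 := by
    rw [Nat.factorization_def _ (by norm_num)]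
    have : (720 : ℕ) = 5 ^ 1 * 144 := by norm_num
    rw [this, padicValNat_base_pow_mul (by norm_num) (by norm_num),
        padicValNat.eq_zero_of_not_dvd (by norm_num)]
  rw [h, h1, pow_one]

theorem norm5_3 (B : Subgroup S) (hB : Nat.card B = 5) :
    ¬ 3 ∣ Nat.card (Subgroup.normalizer (B : Set S)) := by
  have := D.fin
  intro h3
  obtain ⟨t, ht⟩ := exists_prime_orderOf_dvd_card' 3 h3
  have hcyc : IsCyclic B := isCyclic_of_prime_card (p := 5) hB
  have h1 : B.normalizerMonoidHom t = 1 := by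
    apply eq_one_of_coprime (a := 3) (b := 4) _ _ (by norm_num)
    · rw [← ht]; exact orderOf_map_dvd _ _
    · have : Nat.card (MulAut B) = 4 := by
        rw [Nat.card_congr (IsCyclic.mulAutMulEquiv B).toEquiv, hB, Nat.card_eq_fintype_card,
          ZMod.card_units_eq_totient]
        decide
      rw [← this]
      exact orderOf_dvd_natCard _
  have h2 : t ∈ B.normalizerMonoidHom.ker := h1
  rw [Subgroup.normalizerMonoidHom_ker] at h2
  have h2 : (t : S) ∈ Subgroup.centralizer (B : Set S) := h2
  have hoT : Nat.card (Subgroup.zpowers (t : S)) = 3 := by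
    rw [Nat.card_zpowers, Subgroup.orderOf_coe, ht]
  refine D.no35 (Subgroup.zpowers (t : S)) B (IsPGroup.of_card (n := 1) (by rw [hoT, pow_one])) ?_ hB ?_
  · intro hb; rw [hb] at hoT; simp at hoT
  · intro b hb x hx
    have h3 : x ∈ Subgroup.centralizer (B : Set S) := Subgroup.zpowers_le.2 h2 hx
    rw [(Subgroup.mem_centralizer_iff.1 h3 b hb)]
    simpa using hx

theorem n5 : Nat.card (Sylow 5 S) = 36 := by
  have := D.fin
  let P : Sylow 5 S := default
  have h1 := P.card_eq_index_normalizer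
  have h2 := Subgroup.card_mul_index (Subgroup.normalizer (P : Set S))
  rw [← h1, D.card] at h2
  have h3 := D.norm5_3 P (D.card5 P)
  have h4 : 5 ∣ Nat.card (Subgroup.normalizer (P : Set S)) := by
    have h := Subgroup.card_dvd_of_le (Subgroup.le_normalizer (H := (P : Subgroup S)))
    rw [D.card5 P] at h
    exact h
  have h5 := card_sylow_modEq_one 5 S
  change ¬ 3 ∣ Nat.card (Subgroup.normalizer (P : Set S)) at h3
  generalize Nat.card (Subgroup.normalizer (P : Set S)) = a at *
  generalize Nat.card (Sylow 5 S) = n at *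
  have h6 : a ∈ Nat.divisors 720 := by rw [Nat.mem_divisors]; exact ⟨⟨n, h2.symm⟩, by norm_num⟩
  have h7 : ∀ a ∈ Nat.divisors 720, ¬ 3 ∣ a → 5 ∣ a → 720 / a % 5 = 1 → 720 / a = 36 := by
    decide +kernel
  have hn : n = 720 / a := by
    rw [← h2, Nat.mul_div_cancel_left]
    rcases Nat.eq_zero_or_pos a with h | h
    · subst h; simp at h2
    · exact h
  rw [hn]
  apply h7 a h6 h3 h4
  rw [← hn]
  exact h5

theorem norm5 (B : Subgroup S) (hB : Nat.card B = 5) :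
    Nat.card (Subgroup.normalizer (B : Set S)) = 20 := by
  have := D.fin
  let P : Sylow 5 S := Sylow.ofCard B (by
    have := (default : Sylow 5 S).card_eq_multiplicity
    rw [D.card5] at this
    exact hB.trans this)
  have h1 := P.card_eq_index_normalizer
  have h2 := Subgroup.card_mul_index (Subgroup.normalizer (P : Set S))
  rw [← h1, D.card, D.n5] at h2
  change Nat.card (Subgroup.normalizer (B : Set S)) * 36 = 720 at h2
  omega

/-- orders of subgroups containing a given subgroup of order five -/
theorem ord5 (B Y : Subgroup S) (hB : Nat.card B = 5) (hBY : B ≤ Y) :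
    ∃ a n, Nat.card (Subgroup.normalizer (B : Set S) ⊓ Y : Subgroup S) = 5 * a ∧
      Nat.card Y = 5 * a * n ∧ n % 5 = 1 ∧ a ∣ 4 ∧ (2 ∣ a ↔ z ∈ Y) := by
  have := D.fin
  let P : Sylow 5 S := Sylow.ofCard B (by
    have := (default : Sylow 5 S).card_eq_multiplicity
    rw [D.card5] at this
    exact hB.trans this)
  let Q : Sylow 5 Y := P.subtype hBY
  have h1 := Q.card_eq_index_normalizer
  have h2 := card_sylow_modEq_one 5 Y
  have h3 := Subgroup.card_mul_index (Subgroup.normalizer (Q : Set Y))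
  have h4 : Nat.card (Subgroup.normalizer (Q : Set Y)) =
      Nat.card (Subgroup.normalizer (B : Set S) ⊓ Y : Subgroup S) := by
    have h5 : (Subgroup.normalizer (B : Set S) ⊓ Y : Subgroup S).subgroupOf Y = Subgroup.normalizer (Q : Set Y) := by
      ext y
      rw [Subgroup.mem_subgroupOf]
      constructor
      · rintro ⟨h, -⟩
        have h := Subgroup.mem_set_normalizer_iff.1 h
        rw [Subgroup.mem_set_normalizer_iff]
        intro x
        exact h x
      · intro h
        refine ⟨?_, y.2⟩
        have h := Subgroup.mem_set_normalizer_iff.1 h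
        refine Subgroup.mem_set_normalizer_iff.2 ?_
        intro x
        constructor
        · intro hx
          exact (h ⟨x, hBY hx⟩).1 hx
        · intro hx
          have hxY : x ∈ Y := by
            have h6 : (y : S)⁻¹ * ((y : S) * x * (y : S)⁻¹) * y ∈ Y :=
              mul_mem (mul_mem (inv_mem y.2) (hBY hx)) y.2
            simpa [mul_assoc] using h6
          exact (h ⟨x, hxY⟩).2 hx
    rw [← h5]
    exact Nat.card_congr (Subgroup.subgroupOfEquivOfLe inf_le_right).toEquiv
  have h5 : 5 ∣ Nat.card (Subgroup.normalizer (B : Set S) ⊓ Y : Subgroup S) := by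
    rw [← hB]; exact Subgroup.card_dvd_of_le (le_inf Subgroup.le_normalizer hBY)
  obtain ⟨a, ha⟩ := h5
  have h20 : 5 * a ∣ 20 := by
    rw [← ha, ← D.norm5 B hB]; exact Subgroup.card_dvd_of_le inf_le_left
  have ha4 : a ∣ 4 := Nat.dvd_of_mul_dvd_mul_left (by norm_num : 0 < 5) h20
  refine ⟨a, Nat.card (Sylow 5 Y), ha, ?_, h2, ha4, ?_⟩
  · rw [h1, ← ha, ← h4, h3]
  · constructor
    · intro h
      apply D.zmem
      rw [← h3, h4, ha]
      exact Dvd.dvd.mul_right (Dvd.dvd.mul_left h 5) _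
    · intro h
      have h6 : z ∈ (Subgroup.normalizer (B : Set S) ⊓ Y : Subgroup S) := by
        refine ⟨?_, h⟩
        refine Subgroup.mem_set_normalizer_iff.2 ?_
        intro x
        rw [← D.zcent]; simp
      have := D.zeven h6
      rw [ha] at this
      omega

end SLData

end part9

section part10
open scoped Pointwise

theorem claimA_arith (k a n b n' : ℕ) (hk : k = 3 ∨ k = 9) (ha : a ∣ 4) (hb : b ∣ 4) (hab : a ∣ b)
    (h2 : 2 ∣ a ↔ 2 ∣ b) (hn : n % 5 = 1) (hn' : n' % 5 = 1)
    (h : k * (5 * a * n) = 5 * b * n') : False := by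
  have h1 : k * (a * n) = b * n' := by
    have : 5 * (k * (a * n)) = 5 * (b * n') := by rw [mul_left_comm, ← mul_assoc 5 a, h, mul_assoc]
    exact Nat.eq_of_mul_eq_mul_left (by norm_num) this
  have ha4 : a ≤ 4 := Nat.le_of_dvd (by norm_num) ha
  have hb4 : b ≤ 4 := Nat.le_of_dvd (by norm_num) hb
  have h3 : (k * a) % 5 = b % 5 := by
    have h4 : (k * (a * n)) % 5 = (b * n') % 5 := by rw [h1]
    rw [← mul_assoc, Nat.mul_mod, hn, mul_one, Nat.mod_mod, Nat.mul_mod b, hn', mul_one, Nat.mod_mod] at h4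
    exact h4
  rcases hk with rfl | rfl <;> interval_cases a <;> interval_cases b <;> omega

namespace SLData

variable {S : Type u1} {X : Type v1} [Group S] [MulAction S X] {z : S} (D : SLData S X z)
include D

theorem claimA (H : Subgroup S) (m : S)
    (hm : ∀ P : Sylow 3 S, ∃ u ∈ P, ∃ h ∈ H, m = u * h) : m ∈ H := by
  have := D.fin
  obtain ⟨M, hM⟩ := inter_exists 3 H
  have hHM := inter_le 3 H M hM
  by_contra hmH
  have hne : ¬ M ≤ H := fun h => hmH (h ((hM m).2 hm))
  have h5M : 5 ∣ Nat.card M :=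
    D.n3.trans (sylow_trans 3 D.TI3 M (inter_ne 3 H M hM hne))
  let P : Sylow 3 S := default
  have hidx : H.relIndex M = 3 ∨ H.relIndex M = 9 := by
    have h1 := inter_index 3 H M hM P
    have h2 : Nat.card (P ⊓ M : Subgroup S) ∣ 3 ^ 2 := by
      obtain ⟨v, hv⟩ := D.syl3 P
      have h3 := Subgroup.card_dvd_of_le (inf_le_left : (P ⊓ M : Subgroup S) ≤ P)
      rw [hv, D.stab v] at h3
      rw [hv]
      exact h3
    obtain ⟨i, hi, he⟩ := (Nat.dvd_prime_pow Nat.prime_three).1 (h1.trans h2)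
    interval_cases i
    · exact absurd (Subgroup.relIndex_eq_one.1 he) hne
    · left; simpa using he
    · right; simpa using he
  have hcard : H.relIndex M * Nat.card H = Nat.card M := by
    rw [Subgroup.relIndex, mul_comm]
    rw [← Nat.card_congr (Subgroup.subgroupOfEquivOfLe hHM).toEquiv]
    exact Subgroup.card_mul_index _
  have h5H : 5 ∣ Nat.card H := by
    rw [← hcard] at h5M
    rcases (Nat.Prime.dvd_mul (by norm_num)).1 h5M with h | h
    · rcases hidx with h1 | h1 <;> rw [h1] at h <;> norm_num at h
    · exact h
  obtain ⟨b, hb⟩ := exists_prime_orderOf_dvd_card' 5 h5H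
  let B : Subgroup S := Subgroup.zpowers (b : S)
  have hB : Nat.card B = 5 := by rw [Nat.card_zpowers, Subgroup.orderOf_coe, hb]
  have hBH : B ≤ H := Subgroup.zpowers_le.2 b.2
  obtain ⟨a1, n1, hc1, ho1, hn1, ha1, hz1⟩ := D.ord5 B H hB hBH
  obtain ⟨a2, n2, hc2, ho2, hn2, ha2, hz2⟩ := D.ord5 B M hB (hBH.trans hHM)
  have hzz : z ∈ M → z ∈ H := by
    intro hz
    obtain ⟨u, hu, h, hh, he⟩ := (hM z).1 hz P
    have hu9 : u ^ 9 = 1 := by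
      obtain ⟨v, hv⟩ := D.syl3 P
      have hu' : u ∈ MulAction.stabilizer S v := hv ▸ hu
      have := mem_pow_card _ hu'
      rw [D.stab] at this
      exact orderOf_dvd_iff_pow_eq_one.1 this
    have hh' : h = u⁻¹ * z := by rw [he]; simp
    have hz9 : z ^ 9 = z := by
      rw [show 9 = 2 * 4 + 1 from rfl, pow_succ, pow_mul, pow_two, D.z2, one_pow, one_mul]
    have : h ^ 9 = z := by
      rw [hh', (show Commute u⁻¹ z from D.zcent u⁻¹).mul_pow, inv_pow, hu9, hz9]; simp
    rw [← this]; exact pow_mem hh 9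
  refine claimA_arith _ a1 n1 a2 n2 hidx ha1 ha2 ?_ ?_ hn1 hn2 (by rw [← ho1, ← ho2, hcard])
  · have h1 := Subgroup.card_dvd_of_le (inf_le_inf_left (Subgroup.normalizer (B : Set S)) hHM)
    rw [hc1, hc2] at h1
    exact Nat.dvd_of_mul_dvd_mul_left (by norm_num) h1
  · rw [hz1, hz2]; exact ⟨fun h => hHM h, hzz⟩

theorem TI5 (P Q : Sylow 5 S) (x : S) (hx : x ≠ 1) (hP : x ∈ P) (hQ : x ∈ Q) : P = Q := by
  have := D.fin
  have key : ∀ R : Sylow 5 S, x ∈ R → (R : Subgroup S) = Subgroup.zpowers x := by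
    intro R hR
    symm
    apply Subgroup.eq_of_le_of_card_ge (Subgroup.zpowers_le.2 hR)
    have h1 := mem_pow_card (R : Subgroup S) hR
    rw [D.card5 R, Nat.dvd_prime (by norm_num)] at h1
    rw [D.card5 R, Nat.card_zpowers]
    rcases h1 with h1 | h1
    · exact absurd (orderOf_eq_one_iff.1 h1) hx
    · exact h1.ge
  exact Sylow.ext ((key P hP).trans (key Q hQ).symm)

theorem claimB (H : Subgroup S) (m : S)
    (hm : ∀ P : Sylow 5 S, ∃ u ∈ P, ∃ h ∈ H, m = u * h) : m ∈ H := by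
  have := D.fin
  obtain ⟨M, hM⟩ := inter_exists 5 H
  have hHM := inter_le 5 H M hM
  by_contra hmH
  have hne : ¬ M ≤ H := fun h => hmH (h ((hM m).2 hm))
  have h36 : 36 ∣ Nat.card M := by
    rw [← D.n5]; exact sylow_trans 5 D.TI5 M (inter_ne 5 H M hM hne)
  let P : Sylow 5 S := default
  have hidx : H.relIndex M = 5 := by
    have h1 := inter_index 5 H M hM P
    have h3 := h1.trans (Subgroup.card_dvd_of_le (inf_le_left : (P ⊓ M : Subgroup S) ≤ P))
    rw [D.card5 P, Nat.dvd_prime (by norm_num)] at h3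
    rcases h3 with h | h
    · exact absurd (Subgroup.relIndex_eq_one.1 h) hne
    · exact h
  let H' : Subgroup M := H.subgroupOf M
  have hH'c : Nat.card H' = Nat.card H := Nat.card_congr (Subgroup.subgroupOfEquivOfLe hHM).toEquiv
  have hH'i : H'.index = 5 := hidx
  have hcard : Nat.card H' * 5 = Nat.card M := by
    rw [← hH'i]; exact Subgroup.card_mul_index _
  have h5H : ¬ 5 ∣ Nat.card H' := by
    rintro ⟨c, hc⟩
    have h1 : Nat.card M ∣ 720 := by rw [← D.card]; exact Subgroup.card_subgroup_dvd_card M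
    rw [← hcard, hc] at h1
    have h2 : 25 ∣ 720 := (Dvd.intro c (by ring)).trans h1
    norm_num at h2
  let N : Subgroup M := H'.normalCore
  have hNi : N.index ∣ 120 := by
    have h1 : N = (MulAction.toPermHom M (M ⧸ H')).ker := Subgroup.normalCore_eq_ker H'
    rw [h1, Subgroup.index_ker]
    have h2 : Nat.card (Equiv.Perm (M ⧸ H')) = 120 := by
      rw [Nat.card_perm, ← Subgroup.index_eq_card, hH'i]; decide
    rw [← h2]
    exact Subgroup.card_subgroup_dvd_card _
  have h5N : ¬ 5 ∣ Nat.card N := fun h => h5H (h.trans (Subgroup.card_dvd_of_le (Subgroup.normalCore_le H')))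
  have h3N : 3 ∣ Nat.card N := by
    have h1 : 9 ∣ Nat.card M := (by norm_num : 9 ∣ 36).trans h36
    rw [← Subgroup.card_mul_index N] at h1
    by_contra hc
    have hcop : Nat.Coprime 9 (Nat.card N) := by
      have := ((Nat.Prime.coprime_iff_not_dvd (by norm_num : Nat.Prime 3)).2 hc).pow_left 2
      simpa using this
    have h2 := (hcop.dvd_of_dvd_mul_left h1).trans hNi
    norm_num at h2
  let T : Sylow 3 N := default
  have hT : (T : Subgroup N) ≠ ⊥ := by
    intro hb
    have := T.dvd_card_of_dvd_card h3N
    rw [hb] at this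
    simp at this
  have hfr := T.normalizer_sup_eq_top
  set T1 : Subgroup M := (T : Subgroup N).map N.subtype with hT1
  have h5n : 5 ∣ Nat.card (Subgroup.normalizer (T1 : Set M)) := by
    by_contra hc
    have h1 : Nat.card M ∣ Nat.card (Subgroup.normalizer (T1 : Set M)) * Nat.card N := by
      have h2 : N.relIndex (Subgroup.normalizer (T1 : Set M) ⊔ N) = N.index := by
        rw [hfr, Subgroup.relIndex_top_right]
      rw [sup_comm, Subgroup.relIndex_sup_left] at h2
      have h3 : N.index ∣ Nat.card (Subgroup.normalizer (T1 : Set M)) := by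
        rw [← h2]; exact Subgroup.relIndex_dvd_card _ _
      rw [← Subgroup.card_mul_index N, mul_comm]
      exact Nat.mul_dvd_mul_right h3 _
    have h2 : 5 ∣ Nat.card M := ⟨_, by rw [← hcard, mul_comm]⟩
    rcases (Nat.Prime.dvd_mul (by norm_num)).1 (h2.trans h1) with h | h
    · exact hc h
    · exact h5N h
  obtain ⟨b, hb⟩ := exists_prime_orderOf_dvd_card' 5 h5n
  let B0 : Subgroup M := Subgroup.zpowers (b : M)
  have hB0 : Nat.card B0 = 5 := by rw [Nat.card_zpowers, Subgroup.orderOf_coe, hb]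
  refine D.no35 (T1.map M.subtype) (B0.map M.subtype) ?_ ?_ ?_ ?_
  · exact (T.2.map _).map _
  · intro h
    rw [Subgroup.map_eq_bot_iff_of_injective _ M.subtype_injective, hT1,
      Subgroup.map_eq_bot_iff_of_injective _ N.subtype_injective] at h
    exact hT h
  · rw [Subgroup.card_map_of_injective M.subtype_injective, hB0]
  · rintro _ ⟨x, hx, rfl⟩ _ ⟨t, ht, rfl⟩
    refine ⟨x * t * x⁻¹, ?_, by simp⟩
    have h4 : x ∈ Subgroup.normalizer (T1 : Set M) := (Subgroup.zpowers_le.2 b.2) hx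
    exact (Subgroup.mem_set_normalizer_iff.1 h4 t).1 ht

end SLData

end part10

section part11
open scoped Pointwise

theorem fin_step {S : Type u1} [Group S] {Ω : Type w1} [MulAction S Ω] (p : ℕ)
    (claim : ∀ (H : Subgroup S) (m : S), (∀ P : Sylow p S, ∃ u ∈ P, ∃ h ∈ H, m = u * h) → m ∈ H)
    (θ : Ω → Ω) (hθ : ∀ α β, ∃ g : S, θ α = g • α ∧ θ β = g • β) (g0 : S)
    (h : ∀ (P : Sylow p S) (β : Ω), ∃ g : S, g0⁻¹ * g ∈ P ∧ θ β = g • β) (β : Ω) : θ β = g0 • β := by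
  obtain ⟨k, hk, -⟩ := hθ β β
  have hm : g0⁻¹ * k ∈ MulAction.stabilizer S β := by
    apply claim
    intro P
    obtain ⟨g, hg, hgb⟩ := h P β
    refine ⟨_, hg, g⁻¹ * k, ?_, by group⟩
    rw [MulAction.mem_stabilizer_iff, mul_smul, ← hk, hgb, inv_smul_smul]
  rw [MulAction.mem_stabilizer_iff, mul_smul, ← hk, inv_smul_eq_iff] at hm
  exact hm

namespace SLData

variable {S : Type u1} {X : Type v1} [Group S] [MulAction S X] {z : S} (D : SLData S X z)
variable {Ω : Type w1} [MulAction S Ω]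
include D

theorem caseA (θ : Ω → Ω) (hθ : ∀ α β, ∃ g : S, θ α = g • α ∧ θ β = g • β) (α : Ω) (v : X)
    (hle : MulAction.stabilizer S α ≤ MulAction.stabilizer S v) : ∃ g : S, ∀ β, θ β = g • β := by
  have := D.trans
  have h1 : ∀ w : X, ∃ g : S, g • v = w := fun w => MulAction.exists_smul_eq S v w
  choose t ht using h1
  have h2 : ∀ w : X, ∃ g : S, θ (t w • α) = g • (t w • α) := fun w => by
    obtain ⟨g, hg, -⟩ := hθ (t w • α) (t w • α)
    exact ⟨g, hg⟩
  choose k hk using h2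
  have hcomp : ∀ (w : X) (g : S), θ (t w • α) = g • (t w • α) → g • w = k w • w := by
    intro w g hg
    have h3 : (t w)⁻¹ * (k w)⁻¹ * g * t w ∈ MulAction.stabilizer S α := by
      rw [MulAction.mem_stabilizer_iff, mul_smul, mul_smul, ← hg, hk, mul_smul, inv_smul_smul,
        inv_smul_smul]
    have h4 := hle h3
    rw [MulAction.mem_stabilizer_iff, mul_smul, ht, mul_smul, mul_smul, inv_smul_eq_iff, ht,
      inv_smul_eq_iff] at h4
    exact h4
  obtain ⟨g0, hg0⟩ := D.rigid (fun w => k w • w) (by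
    intro w w'
    obtain ⟨g, hg1, hg2⟩ := hθ (t w • α) (t w' • α)
    exact ⟨g, (hcomp w g hg1).symm, (hcomp w' g hg2).symm⟩)
  refine ⟨g0, fin_step 3 D.claimA θ hθ g0 ?_⟩
  intro P β
  obtain ⟨w, hw⟩ := D.syl3 P
  obtain ⟨g, hg1, hg2⟩ := hθ (t w • α) β
  refine ⟨g, ?_, hg2⟩
  have h5 : g0⁻¹ * g ∈ MulAction.stabilizer S w := by
    rw [MulAction.mem_stabilizer_iff, mul_smul, hcomp w g hg1]
    have := hg0 w
    rw [this, inv_smul_smul]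
  rw [← hw] at h5
  exact h5

theorem eq5 (A : Subgroup S) (hA : Nat.card A = 5) (x : S) (hx : x ≠ 1) (hxA : x ∈ A) :
    A = Subgroup.zpowers x := by
  have := D.fin
  symm
  apply Subgroup.eq_of_le_of_card_ge (Subgroup.zpowers_le.2 hxA)
  have h1 := mem_pow_card A hxA
  rw [hA, Nat.dvd_prime (by norm_num)] at h1
  rw [hA, Nat.card_zpowers]
  rcases h1 with h1 | h1
  · exact absurd (orderOf_eq_one_iff.1 h1) hx
  · exact h1.ge

theorem bad_card (A C : Subgroup S) (hA : Nat.card A = 5) (hC : Nat.card C = 5) :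
    ((fun q : S × S => Subgroup.zpowers (q.1 * q.2)) '' (((A : Set S) \ {1}) ×ˢ ((C : Set S) \ {1}))).ncard ≤ 16 := by
  have := D.fin
  have key : ∀ A : Subgroup S, Nat.card A = 5 → ((A : Set S) \ {1}).ncard = 4 := by
    intro A hA
    rw [Set.ncard_sdiff_singleton_of_mem (one_mem A)]
    have : (A : Set S).ncard = Nat.card A := rfl
    rw [this, hA]
  refine (Set.ncard_image_le (Set.toFinite _)).trans ?_
  rw [Set.ncard_prod, key A hA, key C hC]

theorem caseB0 (θ : Ω → Ω) (hθ : ∀ α β, ∃ g : S, θ α = g • α ∧ θ β = g • β) (α : Ω)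
    (hA : Nat.card (MulAction.stabilizer S α) = 5) (hfix : θ α = α) :
    ∃ g : S, ∀ β, θ β = g • β := by
  have := D.fin
  have hst : ∀ x : S, Nat.card (MulAction.stabilizer S (x • α)) = 5 := by
    intro x
    rw [← hA, MulAction.stabilizer_smul_eq_stabilizer_map_conj]
    exact Subgroup.card_map_of_injective (MulAut.conj x).injective
  set A := MulAction.stabilizer S α with hAdef
  have h1 : ∀ x : S, ∃ f ∈ A, θ (x • α) = f • x • α := by
    intro x
    obtain ⟨g, hg1, hg2⟩ := hθ α (x • α)
    exact ⟨g, by rw [hAdef, MulAction.mem_stabilizer_iff, ← hg1, hfix], hg2⟩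
  choose f hfA hf using h1
  let Bad : S → Set (Subgroup S) := fun x =>
    (fun q : S × S => Subgroup.zpowers (q.1 * q.2)) '' (((A : Set S) \ {1}) ×ˢ ((MulAction.stabilizer S (x • α) : Set S) \ {1}))
  have hcomp : ∀ x y : S, MulAction.stabilizer S (x • α) ≠ A → MulAction.stabilizer S (y • α) ≠ A →
      MulAction.stabilizer S (y • α) ∉ Bad x → f x = f y := by
    intro x y hx hy hb
    by_contra hne
    obtain ⟨g, hg1, hg2⟩ := hθ (x • α) (y • α)
    have hs : (f x)⁻¹ * g ∈ MulAction.stabilizer S (x • α) := by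
      rw [MulAction.mem_stabilizer_iff, mul_smul, ← hg1, hf, inv_smul_smul]
    have hs' : (f y)⁻¹ * g ∈ MulAction.stabilizer S (y • α) := by
      rw [MulAction.mem_stabilizer_iff, mul_smul, ← hg2, hf, inv_smul_smul]
    have hp : (f y)⁻¹ * f x ∈ A := mul_mem (inv_mem (hfA y)) (hfA x)
    have hp1 : (f y)⁻¹ * f x ≠ 1 := fun h => hne (inv_mul_eq_one.1 h).symm
    have he : ((f y)⁻¹ * f x) * ((f x)⁻¹ * g) = (f y)⁻¹ * g := by group
    generalize (f y)⁻¹ * f x = p at *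
    generalize (f x)⁻¹ * g = s at *
    generalize (f y)⁻¹ * g = s' at *
    by_cases h1 : s = 1
    · rw [h1, mul_one] at he
      rw [← he] at hs'
      exact hy ((D.eq5 _ (hst y) p hp1 hs').trans (D.eq5 _ hA p hp1 hp).symm)
    · by_cases h2 : s' = 1
      · rw [h2] at he
        have h3 : p ∈ MulAction.stabilizer S (x • α) := by
          rw [mul_eq_one_iff_eq_inv.1 he]; exact inv_mem hs
        exact hx ((D.eq5 _ (hst x) p hp1 h3).trans (D.eq5 _ hA p hp1 hp).symm)
      · apply hb
        refine ⟨(p, s), ⟨⟨hp, hp1⟩, ⟨hs, h1⟩⟩, ?_⟩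
        change Subgroup.zpowers (p * s) = _
        rw [he]
        exact (D.eq5 _ (hst y) s' h2 hs').symm
  have hsyl : ∀ P : Sylow 5 S, ∃ x : S, (P : Subgroup S) = MulAction.stabilizer S (x • α) := by
    intro P
    let Q : Sylow 5 S := Sylow.ofCard A (by
      have := (default : Sylow 5 S).card_eq_multiplicity
      rw [D.card5] at this
      exact hA.trans this)
    obtain ⟨g, hg⟩ := MulAction.exists_smul_eq S Q P
    refine ⟨g, ?_⟩
    rw [← hg, MulAction.stabilizer_smul_eq_stabilizer_map_conj]
    rfl
  have hchoose : ∀ E : Set (Subgroup S), E.ncard < 36 → ∃ x : S, MulAction.stabilizer S (x • α) ∉ E := by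
    intro E hE
    by_contra hc
    have hc : ∀ x : S, MulAction.stabilizer S (x • α) ∈ E := fun x => by
      by_contra h; exact hc ⟨x, h⟩
    have h3 : (Set.range (fun P : Sylow 5 S => (P : Subgroup S))) ⊆ E := by
      rintro _ ⟨P, rfl⟩
      obtain ⟨x, hx⟩ := hsyl P
      change (P : Subgroup S) ∈ E
      rw [hx]; exact hc x
    have h4 := Set.ncard_le_ncard h3 (Set.toFinite _)
    have h5 : (Set.range (fun P : Sylow 5 S => (P : Subgroup S))).ncard = 36 := by
      rw [← D.n5]
      exact Nat.card_range_of_injective (fun P Q h => Sylow.ext h)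
    omega
  have hconst : ∀ x y : S, MulAction.stabilizer S (x • α) ≠ A → MulAction.stabilizer S (y • α) ≠ A →
      f x = f y := by
    intro x y hx hy
    obtain ⟨c, hc⟩ := hchoose ({A} ∪ (Bad x ∪ Bad y)) (by
      have h1 := Set.ncard_union_le {A} (Bad x ∪ Bad y)
      have h2 := Set.ncard_union_le (Bad x) (Bad y)
      have h3 : (Bad x).ncard ≤ 16 := D.bad_card _ _ hA (hst x)
      have h4 : (Bad y).ncard ≤ 16 := D.bad_card _ _ hA (hst y)
      rw [Set.ncard_singleton] at h1
      omega)
    have hcA : MulAction.stabilizer S (c • α) ≠ A := fun h => hc (Or.inl h)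
    exact (hcomp x c hx hcA (fun h => hc (Or.inr (Or.inl h)))).trans
      (hcomp y c hy hcA (fun h => hc (Or.inr (Or.inr h)))).symm
  obtain ⟨a0, ha0⟩ := hchoose {A} (by rw [Set.ncard_singleton]; norm_num)
  have hall : ∀ x : S, θ (x • α) = f a0 • x • α := by
    intro x
    by_cases hx : MulAction.stabilizer S (x • α) = A
    · have h1 := hfA x
      have h2 := hfA a0
      rw [← hx, MulAction.mem_stabilizer_iff] at h1 h2
      rw [hf, h1, h2]
    · rw [hf, hconst x a0 hx ha0]
  refine ⟨f a0, fin_step 5 D.claimB θ hθ (f a0) ?_⟩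
  intro P β
  obtain ⟨x, hx⟩ := hsyl P
  obtain ⟨g, hg1, hg2⟩ := hθ (x • α) β
  refine ⟨g, ?_, hg2⟩
  have h5 : (f a0)⁻¹ * g ∈ MulAction.stabilizer S (x • α) := by
    rw [MulAction.mem_stabilizer_iff, mul_smul, ← hg1, hall, inv_smul_smul]
  rw [← hx] at h5
  exact h5

theorem closed [FaithfulSMul S Ω] (θ : Ω → Ω)
    (hθ : ∀ α β, ∃ g : S, θ α = g • α ∧ θ β = g • β) : ∃ g : S, ∀ β, θ β = g • β := by
  have := D.fin
  obtain ⟨α, hα⟩ : ∃ α : Ω, z • α ≠ α := by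
    by_contra hc
    have hc : ∀ α : Ω, z • α = α := fun α => by by_contra h; exact hc ⟨α, h⟩
    exact D.zne (FaithfulSMul.eq_of_smul_eq_smul (α := Ω) (fun α => by rw [hc, one_smul]))
  have hz : z ∉ MulAction.stabilizer S α := hα
  have hodd : ¬ 2 ∣ Nat.card (MulAction.stabilizer S α) := fun h => hz (D.zmem h)
  have hdvd : Nat.card (MulAction.stabilizer S α) ∣ 720 := by
    rw [← D.card]; exact Subgroup.card_subgroup_dvd_card _
  by_cases h5 : 5 ∣ Nat.card (MulAction.stabilizer S α)
  · have hA : Nat.card (MulAction.stabilizer S α) = 5 := by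
      obtain ⟨b, hb⟩ := exists_prime_orderOf_dvd_card' 5 h5
      obtain ⟨a, n, -, h1, h2, h3, h4⟩ := D.ord5 (Subgroup.zpowers (b : S)) (MulAction.stabilizer S α)
        (by rw [Nat.card_zpowers, Subgroup.orderOf_coe, hb]) (Subgroup.zpowers_le.2 b.2)
      have h6 : ¬ 2 ∣ a := fun h => hz (h4.1 h)
      have ha1 : a = 1 := by
        have := Nat.le_of_dvd (by norm_num) h3
        interval_cases a <;> omega
      subst ha1
      have h7 : ∀ m ∈ Nat.divisors 720, ¬ 2 ∣ m → 5 ∣ m → m / 5 % 5 = 1 → m = 5 := by decide +kernel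
      apply h7 _ (Nat.mem_divisors.2 ⟨hdvd, by norm_num⟩) hodd h5
      rw [h1]
      omega
    obtain ⟨g0, hg0, -⟩ := hθ α α
    obtain ⟨g, hg⟩ := D.caseB0 (fun β => g0⁻¹ • θ β) (by
      intro β γ
      obtain ⟨g, h1, h2⟩ := hθ β γ
      exact ⟨g0⁻¹ * g, by simp only [h1, mul_smul], by simp only [h2, mul_smul]⟩) α hA
      (by simp only [hg0, inv_smul_smul])
    refine ⟨g0 * g, fun β => ?_⟩
    rw [mul_smul, ← hg, smul_inv_smul]
  · have h9 : Nat.card (MulAction.stabilizer S α) ∣ 3 ^ 2 := by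
      have h7 : ∀ m ∈ Nat.divisors 720, ¬ 2 ∣ m → ¬ 5 ∣ m → m ∣ 3 ^ 2 := by decide +kernel
      exact h7 _ (Nat.mem_divisors.2 ⟨hdvd, by norm_num⟩) hodd h5
    obtain ⟨i, -, hi⟩ := (Nat.dvd_prime_pow Nat.prime_three).1 h9
    obtain ⟨v, hv⟩ := D.le3 (IsPGroup.of_card hi)
    exact D.caseA θ hθ α v hv

theorem tot : IsTotally2Closed.{u1, w1} S := by
  intro Ω H ⟨e⟩
  let _ : MulAction S Ω := MulAction.compHom Ω (H.subtype.comp e.toMonoidHom)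
  have hsm : ∀ (g : S) (α : Ω), g • α = (e g : Equiv.Perm Ω) α := fun _ _ => rfl
  have : FaithfulSMul S Ω := ⟨fun {a b} h => by
    apply e.injective
    apply Subtype.ext
    ext α
    exact h α⟩
  apply le_antisymm
  · intro θ hθ
    obtain ⟨g, hg⟩ := D.closed (fun α : Ω => θ α) (by
      intro α β
      obtain ⟨h, hh, h1, h2⟩ := hθ α β
      refine ⟨e.symm ⟨h, hh⟩, ?_, ?_⟩
      · rw [hsm, e.apply_symm_apply]; exact h1
      · rw [hsm, e.apply_symm_apply]; exact h2)
    have : θ = (e g : Equiv.Perm Ω) := Equiv.ext hg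
    rw [this]; exact (e g).2
  · intro h hh α β
    exact ⟨h, hh, rfl, rfl⟩

end SLData

end part11

section part12

abbrev SLt (F : Type u1) [Field F] := Matrix.SpecialLinearGroup (Fin 2) F

def NzP (F : Type u1) [Field F] : Type u1 := {p : F × F // p ≠ 0}

namespace NzP
variable {F : Type u1} [Field F]

theorem det_eq (g : SLt F) : g.1 0 0 * g.1 1 1 - g.1 0 1 * g.1 1 0 = 1 := by
  have := g.2
  rwa [Matrix.det_fin_two] at this

theorem pne {p : F × F} (h : p ≠ 0) : p.1 ≠ 0 ∨ p.2 ≠ 0 := by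
  by_contra hc
  push Not at hc
  exact h (Prod.ext hc.1 hc.2)

def act (g : SLt F) (p : F × F) : F × F :=
  (g.1 0 0 * p.1 + g.1 0 1 * p.2, g.1 1 0 * p.1 + g.1 1 1 * p.2)

theorem act_mul (g h : SLt F) (p : F × F) : act (g * h) p = act g (act h p) := by
  simp only [act, Matrix.SpecialLinearGroup.coe_mul, Matrix.mul_apply, Fin.sum_univ_two]
  ext <;> simp <;> ring

theorem act_one (p : F × F) : act (1 : SLt F) p = p := by
  simp [act]

theorem act_ne (g : SLt F) {p : F × F} (h : p ≠ 0) : act g p ≠ 0 := by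
  intro hc
  apply h
  have := act_mul g⁻¹ g p
  rw [inv_mul_cancel, act_one, hc] at this
  rw [this]; simp [act]

instance : MulAction (SLt F) (NzP F) where
  smul g v := ⟨act g v.1, act_ne g v.2⟩
  one_smul v := Subtype.ext (act_one v.1)
  mul_smul g h v := Subtype.ext (act_mul g h v.1)

theorem smul_val (g : SLt F) (v : NzP F) : (g • v).1 = act g v.1 := rfl

theorem fix_iff (g : SLt F) (v : NzP F) : g • v = v ↔
    (g.1 0 0 * v.1.1 + g.1 0 1 * v.1.2 = v.1.1 ∧ g.1 1 0 * v.1.1 + g.1 1 1 * v.1.2 = v.1.2) := by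
  constructor
  · intro h
    have h1 := congrArg Subtype.val h
    rw [smul_val] at h1
    exact ⟨congrArg Prod.fst h1, congrArg Prod.snd h1⟩
  · intro h
    exact Subtype.ext (Prod.ext h.1 h.2)

theorem eq_one (g : SLt F) (v w : NzP F) (hv : g • v = v) (hw : g • w = w)
    (hD : v.1.1 * w.1.2 - v.1.2 * w.1.1 ≠ 0) : g = 1 := by
  rw [fix_iff] at hv hw
  obtain ⟨v1, v2⟩ := hv
  obtain ⟨w1, w2⟩ := hw
  ext i j
  apply mul_right_cancel₀ hD
  fin_cases i <;> fin_cases j <;> simp <;> grind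

theorem par (v w : NzP F) (hD : v.1.1 * w.1.2 - v.1.2 * w.1.1 = 0) :
    ∃ c : Fˣ, w.1.1 = c * v.1.1 ∧ w.1.2 = c * v.1.2 := by
  have hw := pne w.2
  rcases pne v.2 with h | h
  · have hw1 : w.1.1 ≠ 0 := by
      intro h0
      rw [h0] at hD
      have : w.1.2 = 0 := by
        have h3 : v.1.1 * w.1.2 = 0 := by linear_combination hD
        exact (mul_eq_zero.1 h3).resolve_left h
      rcases hw with h1 | h1
      · exact h1 h0
      · exact h1 this
    refine ⟨Units.mk0 (w.1.1 / v.1.1) (div_ne_zero hw1 h), ?_, ?_⟩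
    · simp; field_simp
    · simp; field_simp; linear_combination hD
  · have hw1 : w.1.2 ≠ 0 := by
      intro h0
      rw [h0] at hD
      have : w.1.1 = 0 := by
        have h3 : v.1.2 * w.1.1 = 0 := by linear_combination -hD
        exact (mul_eq_zero.1 h3).resolve_left h
      rcases hw with h1 | h1
      · exact h1 this
      · exact h1 h0
    refine ⟨Units.mk0 (w.1.2 / v.1.2) (div_ne_zero hw1 h), ?_, ?_⟩
    · simp; field_simp; linear_combination -hD
    · simp; field_simp

theorem par_of (g : SLt F) (hg : g ≠ 1) (v w : NzP F) (hv : g • v = v) (hw : g • w = w) :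
    ∃ c : Fˣ, w.1.1 = c * v.1.1 ∧ w.1.2 = c * v.1.2 := by
  apply par
  by_contra hD
  exact hg (eq_one g v w hv hw hD)

theorem fix_par (g : SLt F) (v w : NzP F) (c : Fˣ) (h1 : w.1.1 = c * v.1.1)
    (h2 : w.1.2 = c * v.1.2) : g • w = w ↔ g • v = v := by
  rw [fix_iff, fix_iff, h1, h2]
  constructor
  · rintro ⟨h3, h4⟩
    exact ⟨mul_left_cancel₀ c.ne_zero (by linear_combination h3),
      mul_left_cancel₀ c.ne_zero (by linear_combination h4)⟩
  · rintro ⟨h3, h4⟩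
    exact ⟨by linear_combination (c : F) * h3, by linear_combination (c : F) * h4⟩

theorem fixs' (g : SLt F) (hg : g ≠ 1) (v w : NzP F) (hv : g • v = v) (hw : g • w = w) :
    MulAction.stabilizer (SLt F) w = MulAction.stabilizer (SLt F) v := by
  obtain ⟨c, h1, h2⟩ := par_of g hg v w hv hw
  ext h
  rw [MulAction.mem_stabilizer_iff, MulAction.mem_stabilizer_iff]
  exact fix_par h v w c h1 h2

def sc (c : Fˣ) (v : NzP F) : NzP F := ⟨(c * v.1.1, c * v.1.2), by
  intro h
  have h1 : (c : F) * v.1.1 = 0 := congrArg Prod.fst h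
  have h2 : (c : F) * v.1.2 = 0 := congrArg Prod.snd h
  have h3 := (mul_eq_zero.1 h1).resolve_left c.ne_zero
  have h4 := (mul_eq_zero.1 h2).resolve_left c.ne_zero
  exact v.2 (Prod.ext h3 h4)⟩

theorem fixc' (hF : Nat.card F = 9) (g : SLt F) (hg : g ≠ 1) (v : NzP F) (hv : g • v = v) :
    Nat.card {w : NzP F // g • w = w} = 8 := by
  have : Finite F := Nat.finite_of_card_ne_zero (by omega)
  have h8 : Nat.card Fˣ = 8 := by
    have := Nat.card_eq_card_units_add_one F
    omega
  rw [← h8]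
  symm
  refine Nat.card_congr (Equiv.ofBijective
    (fun c : Fˣ => (⟨sc c v, (fix_par g v (sc c v) c rfl rfl).2 hv⟩ : {w : NzP F // g • w = w}))
    ⟨?_, ?_⟩)
  · intro c d h
    have h1 := congrArg Subtype.val (congrArg Subtype.val h)
    have h2 : (c : F) * v.1.1 = d * v.1.1 := congrArg Prod.fst h1
    have h3 : (c : F) * v.1.2 = d * v.1.2 := congrArg Prod.snd h1
    apply Units.ext
    rcases pne v.2 with h | h
    · exact mul_right_cancel₀ h h2
    · exact mul_right_cancel₀ h h3
  · rintro ⟨w, hw⟩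
    obtain ⟨c, h1, h2⟩ := par_of g hg v w hv hw
    exact ⟨c, Subtype.ext (Subtype.ext (Prod.ext h1.symm h2.symm))⟩

def tv (v : NzP F) (t : F) : SLt F :=
  ⟨!![1 - t * v.1.1 * v.1.2, t * v.1.1 ^ 2; - t * v.1.2 ^ 2, 1 + t * v.1.1 * v.1.2], by
    rw [Matrix.det_fin_two_of]; ring⟩

theorem tv_fix (v : NzP F) (t : F) : tv v t • v = v := by
  rw [fix_iff]
  constructor <;> simp [tv] <;> ring

theorem stab' (hF : Nat.card F = 9) (v : NzP F) :
    Nat.card (MulAction.stabilizer (SLt F) v) = 9 := by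
  rw [← hF]
  symm
  refine Nat.card_congr (Equiv.ofBijective
    (fun t : F => (⟨tv v t, tv_fix v t⟩ : MulAction.stabilizer (SLt F) v)) ⟨?_, ?_⟩)
  · intro t s h
    have h1 := congrArg Subtype.val (congrArg Subtype.val h)
    have h2 := congrFun (congrFun h1 0) 1
    have h3 := congrFun (congrFun h1 1) 0
    simp [tv] at h2 h3
    rcases pne v.2 with h | h
    · exact h2.resolve_right h
    · exact h3.resolve_right h
  · rintro ⟨g, hg⟩
    rw [MulAction.mem_stabilizer_iff, fix_iff] at hg
    obtain ⟨h1, h2⟩ := hg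
    have hd := det_eq g
    rcases pne v.2 with h | h
    · refine ⟨g.1 0 1 / v.1.1 ^ 2, Subtype.ext ?_⟩
      have hD : g.1 1 1 * v.1.1 = v.1.1 + g.1 0 1 * v.1.2 := by
        linear_combination g.1 0 1 * h2 + v.1.1 * hd - g.1 1 1 * h1
      ext i j
      fin_cases i <;> fin_cases j <;> simp [tv]
      · field_simp; linear_combination -h1
      · field_simp
      · field_simp; linear_combination - v.1.1 * h2 + v.1.2 * hD
      · field_simp; linear_combination -hD
    · refine ⟨- g.1 1 0 / v.1.2 ^ 2, Subtype.ext ?_⟩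
      have hA : g.1 0 0 * v.1.2 = v.1.2 + g.1 1 0 * v.1.1 := by
        linear_combination g.1 1 0 * h1 + v.1.2 * hd - g.1 0 0 * h2
      ext i j
      fin_cases i <;> fin_cases j <;> simp [tv]
      · field_simp; linear_combination -hA
      · field_simp; linear_combination - v.1.2 * h1 + v.1.1 * hA
      · field_simp
      · field_simp; linear_combination -h2

def e1 : NzP F := ⟨(1, 0), by simp⟩
def e2 : NzP F := ⟨(0, 1), by simp⟩

theorem ex_e1 (v : NzP F) : ∃ g : SLt F, g • e1 = v := by
  rcases pne v.2 with h | h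
  · refine ⟨⟨!![v.1.1, 0; v.1.2, 1 / v.1.1], ?_⟩, ?_⟩
    · rw [Matrix.det_fin_two_of]; field_simp; simp
    · apply Subtype.ext
      change act _ e1.1 = v.1
      ext <;> simp [act, e1]
  · refine ⟨⟨!![v.1.1, - 1 / v.1.2; v.1.2, 0], ?_⟩, ?_⟩
    · rw [Matrix.det_fin_two_of]; field_simp; simp
    · apply Subtype.ext
      change act _ e1.1 = v.1
      ext <;> simp [act, e1]

theorem trans' : MulAction.IsPretransitive (SLt F) (NzP F) := by
  constructor
  intro v w
  obtain ⟨g, rfl⟩ := ex_e1 v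
  obtain ⟨h, rfl⟩ := ex_e1 w
  exact ⟨h * g⁻¹, by rw [mul_smul, inv_smul_smul]⟩

theorem cardX (hF : Nat.card F = 9) : Nat.card (NzP F) = 80 := by
  have : Finite F := Nat.finite_of_card_ne_zero (by omega)
  have h1 : Nat.card (F × F) = 81 := by rw [Nat.card_prod, hF]
  classical
  have := Fintype.ofFinite F
  rw [Nat.card_eq_fintype_card] at h1
  have h2 : Nat.card {p : F × F // ¬ (p = 0)} = 80 := by
    rw [Nat.card_eq_fintype_card, Fintype.card_subtype_compl, h1]
    simp
  exact h2

theorem card' (hF : Nat.card F = 9) : Nat.card (SLt F) = 720 := by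
  have := trans' (F := F)
  have h := Subgroup.card_mul_index (MulAction.stabilizer (SLt F) (e1 : NzP F))
  rw [MulAction.index_stabilizer_of_transitive, stab' hF, cardX hF] at h
  omega

theorem cross (g : SLt F) (v w : F × F) :
    (act g v).1 * (act g w).2 - (act g v).2 * (act g w).1 = v.1 * w.2 - v.2 * w.1 := by
  have := det_eq g
  simp only [act]
  linear_combination (v.1 * w.2 - v.2 * w.1) * this

theorem rigid' (θ : NzP F → NzP F)
    (hθ : ∀ v w, ∃ g : SLt F, θ v = g • v ∧ θ w = g • w) : ∃ g : SLt F, ∀ v, θ v = g • v := by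
  obtain ⟨g, hg1, hg2⟩ := hθ e1 e2
  refine ⟨g, fun w => ?_⟩
  obtain ⟨h, a1, a2⟩ := hθ e1 w
  obtain ⟨k, b1, b2⟩ := hθ e2 w
  have c1 := cross h e1.1 w.1
  have c2 := cross k e2.1 w.1
  rw [← smul_val, ← smul_val, ← a1, ← a2, hg1] at c1
  rw [← smul_val, ← smul_val, ← b1, ← b2, hg2] at c2
  have hd := det_eq g
  rw [smul_val] at c1 c2
  simp only [act, e1, e2] at c1 c2
  apply Subtype.ext
  rw [smul_val]
  generalize (θ w).1 = p at *
  ext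
  · simp only [act]
    linear_combination (-p.1) * hd + g.1 0 1 * c1 - g.1 0 0 * c2
  · simp only [act]
    linear_combination (-p.2) * hd + g.1 1 1 * c1 - g.1 1 0 * c2

theorem two_ne (hF : Nat.card F = 9) : (2 : F) ≠ 0 := by
  intro h
  have : Finite F := Nat.finite_of_card_ne_zero (by omega)
  have := Fintype.ofFinite F
  have h9 : (Nat.card F : F) = 0 := by
    rw [Nat.card_eq_fintype_card]; exact Nat.cast_card_eq_zero F
  rw [hF] at h9
  push_cast at h9
  exact one_ne_zero (α := F) (by linear_combination h9 - 4 * h)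

theorem inv' (hF : Nat.card F = 9) (x : SLt F) (hx : x * x = 1) : x = 1 ∨ x = -1 := by
  have h2 := two_ne hF
  have hi : x⁻¹ = x := inv_eq_of_mul_eq_one_left hx
  have hi' := congrArg Subtype.val hi
  rw [Matrix.SpecialLinearGroup.SL2_inv_expl] at hi'
  have h00 := congrFun (congrFun hi' 0) 0
  have h01 := congrFun (congrFun hi' 0) 1
  have h10 := congrFun (congrFun hi' 1) 0
  simp at h00 h01 h10
  have hd := det_eq x
  have b0 : x.1 0 1 = 0 := by
    have : (2 : F) * x.1 0 1 = 0 := by linear_combination - h01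
    exact (mul_eq_zero.1 this).resolve_left h2
  have c0 : x.1 1 0 = 0 := by
    have : (2 : F) * x.1 1 0 = 0 := by linear_combination - h10
    exact (mul_eq_zero.1 this).resolve_left h2
  have ha : (x.1 0 0 - 1) * (x.1 0 0 + 1) = 0 := by
    rw [b0, h00] at hd
    linear_combination hd
  rcases mul_eq_zero.1 ha with h | h
  · left
    have ha1 : x.1 0 0 = 1 := by linear_combination h
    ext i j
    fin_cases i <;> fin_cases j <;> simp [b0, c0, h00, ha1]
  · right
    have ha1 : x.1 0 0 = -1 := by linear_combination h
    ext i j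
    fin_cases i <;> fin_cases j <;> simp [b0, c0, h00, ha1]

theorem neg_ne (hF : Nat.card F = 9) : (-1 : SLt F) ≠ 1 := by
  intro h
  have h1 := congrFun (congrFun (congrArg Subtype.val h) 0) 0
  simp at h1
  exact two_ne hF (by linear_combination -h1)

theorem data (hF : Nat.card F = 9) : SLData (SLt F) (NzP F) (-1) where
  card := card' hF
  z2 := by simp
  zne := neg_ne hF
  inv := inv' hF
  ne := ⟨e1⟩
  stab := stab' hF
  trans := trans'
  fixc := fixc' hF
  fixs := fixs'
  rigid := rigid'

theorem exa (hF : Nat.card F = 9) : ∃ a : F, a ≠ 0 ∧ a ^ 2 ≠ 1 := by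
  have : Finite F := Nat.finite_of_card_ne_zero (by omega)
  obtain ⟨x, hx⟩ : IsCyclic Fˣ := by infer_instance
  refine ⟨x, Units.ne_zero x, fun h ↦ ?_⟩
  have h1 := Nat.card_eq_card_units_add_one F
  have h2 := orderOf_eq_card_of_forall_mem_zpowers hx
  have h3 := orderOf_le_of_pow_eq_one zero_lt_two (Units.ext <| by simpa using h : x ^ 2 = 1)
  omega

theorem perf (hF : Nat.card F = 9) : Group.IsPerfect (SLt F) := by
  obtain ⟨a, ha, hb⟩ := exa hF
  exact ⟨Matrix.SL2.commutator_eq_top ha hb⟩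

theorem nsol (hF : Nat.card F = 9) : ¬ Group.IsSolvable (SLt F) := by
  have := perf hF
  have : Nontrivial (SLt F) := ⟨-1, 1, neg_ne hF⟩
  exact Group.IsPerfect.not_isSolvable _

theorem fitt (hF : Nat.card F = 9) : IsFittingSubgroup (Subgroup.center (SLt F)) := by
  refine ⟨inferInstance, nilp_of_comm _ ?_, ?_⟩
  · intro a ha b hb
    exact (Subgroup.mem_center_iff.1 ha b).symm
  · intro N hN hnil
    have := perf hF
    have hs : IsSimpleGroup (SLt F ⧸ Subgroup.center (SLt F)) :=
      Matrix.ProjectiveSpecialLinearGroup.rank_two_simple' (exa hF)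
    have hns : ¬ Group.IsSolvable (SLt F ⧸ Subgroup.center (SLt F)) :=
      Group.IsPerfect.not_isSolvable _
    have hmn : (N.map (QuotientGroup.mk' (Subgroup.center (SLt F)))).Normal :=
      hN.map _ (QuotientGroup.mk'_surjective _)
    rcases hmn.eq_bot_or_eq_top with h | h
    · rw [Subgroup.map_eq_bot_iff, QuotientGroup.ker_mk'] at h
      exact h
    · exfalso
      apply hns
      have hNs : Group.IsSolvable N := inferInstance
      refine Group.isSolvable_of_surjective
        (f := (QuotientGroup.mk' (Subgroup.center (SLt F))).comp N.subtype) ?_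
      rw [← MonoidHom.range_eq_top, MonoidHom.range_comp, Subgroup.range_subtype]
      exact h

theorem cne (hF : Nat.card F = 9) : Subgroup.center (SLt F) ≠ ⊥ := by
  intro h
  have : (-1 : SLt F) ∈ Subgroup.center (SLt F) := by
    rw [Subgroup.mem_center_iff]; intro g; simp
  rw [h, Subgroup.mem_bot] at this
  exact neg_ne hF this

end NzP

theorem ex_field9 : ∃ (F : Type u1) (_ : Field F), Nat.card F = 9 := by
  have : Fact (Nat.Prime 3) := ⟨by norm_num⟩
  refine ⟨ULift.{u1} (GaloisField 3 2), inferInstance, ?_⟩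
  rw [Nat.card_congr Equiv.ulift, GaloisField.card 3 2 (by norm_num)]
  norm_num

end part12

theorem minimal_insoluble_totally_two_closed_structure
    (G : Type u) [Group G] [Finite G]
    (hins : ¬ IsSolvable G) (h2c : IsTotally2Closed G)
    (F : Subgroup G) (hF : IsFittingSubgroup F) (hFnt : F ≠ ⊥)
    (hmin : ∀ (G' : Type u) [Group G'] [Finite G'],
      Nat.card G' < Nat.card G → ¬ IsSolvable G' → IsTotally2Closed G' →
      ∀ F' : Subgroup G', IsFittingSubgroup F' → F' = ⊥) :
    F = Subgroup.center G ∧ IsCyclic (Subgroup.center G) ∧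
      ∃ M : Subgroup (G ⧸ Subgroup.center G),
        IsMinimalNormal M ∧ (¬ ∀ x ∈ M, ∀ y ∈ M, x * y = y * x) ∧
        ∀ M' : Subgroup (G ⧸ Subgroup.center G), IsMinimalNormal M' → M' = M := by
  have hcard : Nat.card G ≤ 720 := by
    by_contra hc
    obtain ⟨K, hK, h9⟩ := ex_field9.{u}
    have D := NzP.data h9
    have := D.fin
    exact NzP.cne h9 (hmin (SLt K) (by rw [D.card]; omega) (NzP.nsol h9) D.tot _ (NzP.fitt h9))
  refine main720 hins (twc_of h2c) hcard F hF hFnt (fit_abelian hins hcard F hF ?_)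
  intro K hK hC hne hs F' hF'
  refine hmin K ?_ hs (of_twc (twc_normal (twc_of h2c) K hC)) F' hF'
  have h1 := Subgroup.card_le_card_group K
  exact lt_of_le_of_ne h1 fun h => hne (Subgroup.eq_top_of_card_eq K h)
end

section
/- Let G be a finite totally 2-closed group and suppose G = HK for proper subgroups H and K of G. If the normal cores satisfy H_G ∩ K_G = 1, then G is the internal direct product G = H_G × K_G, and both H_G and K_G are totally 2-closed. -/
theorem t2c_hom_aux.{u, v} {G : Type u} [Group G] (h : IsTotally2Closed.{u, v} G) {X : Type v}
    (φ : G →* Equiv.Perm X) (hφ : Function.Injective φ) (θ : Equiv.Perm X)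
    (hθ : ∀ α β : X, ∃ g, θ α = φ g α ∧ θ β = φ g β) : ∃ g, θ = φ g := by
  have h1 := h X φ.range ⟨MonoidHom.ofInjective hφ⟩
  have h2 : θ ∈ twoClosure φ.range := by
    intro α β
    obtain ⟨g, h1, h2⟩ := hθ α β
    exact ⟨φ g, ⟨g, rfl⟩, h1, h2⟩
  rw [h1] at h2
  obtain ⟨g, hg⟩ := h2
  exact ⟨g, hg.symm⟩

theorem t2c_hom.{u, v, w} {G : Type u} [Group G] [Finite G] (h : IsTotally2Closed.{u, v} G)
    {X : Type w}
    (φ : G →* Equiv.Perm X) (hφ : Function.Injective φ) (θ : Equiv.Perm X)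
    (hθ : ∀ α β : X, ∃ g, θ α = φ g α ∧ θ β = φ g β) : ∃ g, θ = φ g := by
  by_contra hne
  push Not at hne
  have hx : ∀ g, ∃ x, θ x ≠ φ g x := fun g => by
    by_contra hc
    push Not at hc
    exact hne g (Equiv.ext hc)
  have hy : ∀ g, ∃ y, g ≠ 1 → φ g y ≠ y := fun g => by
    by_cases hg : g = 1
    · obtain ⟨x, _⟩ := hx 1
      exact ⟨x, fun h => absurd hg h⟩
    · by_contra hc
      push Not at hc
      apply hg
      apply hφ
      rw [map_one]
      exact Equiv.ext fun y => (hc y).2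
  choose x hx using hx
  choose y hy using hy
  let S : Set X := Set.range (fun p : G × (G ⊕ G) => φ p.1 (Sum.elim x y p.2))
  have hS : ∀ g z, φ g z ∈ S ↔ z ∈ S := by
    have key : ∀ g z, z ∈ S → φ g z ∈ S := by
      rintro g _ ⟨⟨k, s⟩, rfl⟩
      exact ⟨(g * k, s), by simp⟩
    intro g z
    refine ⟨fun hz => ?_, key g z⟩
    have := key g⁻¹ _ hz
    simpa using this
  have hθS : ∀ z, θ z ∈ S ↔ z ∈ S := by
    intro z
    obtain ⟨g, hg, _⟩ := hθ z z
    rw [hg, hS]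
  have hxS : ∀ g, x g ∈ S := fun g => ⟨(1, Sum.inl g), by simp⟩
  have hyS : ∀ g, y g ∈ S := fun g => ⟨(1, Sum.inr g), by simp⟩
  have : Finite S := Set.finite_range _
  obtain ⟨n, ⟨e0⟩⟩ := Finite.exists_equiv_fin S
  let e : S ≃ ULift.{v} (Fin n) := e0.trans Equiv.ulift.symm
  let φS : G →* Equiv.Perm S :=
    { toFun := fun g => (φ g).subtypePerm (hS g)
      map_one' := by ext; simp
      map_mul' := fun a b => by
        apply Equiv.ext
        intro z
        apply Subtype.ext
        change φ (a * b) z = φ a (φ b z)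
        rw [map_mul]; rfl }
  let ψ : G →* Equiv.Perm (ULift.{v} (Fin n)) := e.permCongrHom.toMonoidHom.comp φS
  have hψ : Function.Injective ψ := by
    rw [injective_iff_map_eq_one]
    intro g hg
    by_contra hg1
    have h3 : φS g = 1 := e.permCongrHom.injective (by rw [map_one]; exact hg)
    have h4 := congrArg Subtype.val (Equiv.congr_fun h3 ⟨y g, hyS g⟩)
    exact hy g hg1 h4
  obtain ⟨g, hg⟩ := t2c_hom_aux h ψ hψ (e.permCongrHom (θ.subtypePerm hθS)) (by
    intro α β
    obtain ⟨g, h1, h2⟩ := hθ (e.symm α) (e.symm β)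
    refine ⟨g, congrArg e (Subtype.ext h1), congrArg e (Subtype.ext h2)⟩)
  have h3 : θ.subtypePerm hθS = φS g := e.permCongrHom.injective hg
  exact hx g (congrArg Subtype.val (Equiv.congr_fun h3 ⟨x g, hxS g⟩))

theorem t2c_factor.{u, v, w} {G : Type u} [Group G] [Finite G] (h : IsTotally2Closed.{u, v} G)
    (A B : Subgroup G) [A.Normal] [B.Normal] (hd : A ⊓ B = ⊥) (hs : A ⊔ B = ⊤) :
    IsTotally2Closed.{u, w} A := by
  have comm : ∀ (a : A) (b : B), Commute (A.subtype a) (B.subtype b) := fun a b =>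
    Subgroup.commute_of_normal_of_disjoint A B inferInstance inferInstance
      (disjoint_iff.mpr hd) a b a.2 b.2
  let f : A × B →* G := MonoidHom.noncommCoprod A.subtype B.subtype comm
  have hf : Function.Bijective f := by
    constructor
    · rw [injective_iff_map_eq_one]
      rintro ⟨a, b⟩ hab
      have hab' : (a : G) * b = 1 := hab
      have h1 : (a : G) ∈ A ⊓ B :=
        ⟨a.2, by rw [eq_inv_of_mul_eq_one_left hab']; exact B.inv_mem b.2⟩
      rw [hd, Subgroup.mem_bot] at h1
      have h2 : (b : G) = 1 := by simpa [h1] using hab'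
      exact Prod.ext (Subtype.ext h1) (Subtype.ext h2)
    · intro g
      have hg : g ∈ A ⊔ B := hs ▸ Subgroup.mem_top g
      obtain ⟨a, ha, b, hb, rfl⟩ := Subgroup.mem_sup_of_normal_left.mp hg
      exact ⟨(⟨a, ha⟩, ⟨b, hb⟩), rfl⟩
  let E : A × B ≃* G := MulEquiv.ofBijective f hf
  rintro Ω P ⟨i⟩
  apply le_antisymm
  · intro θ hθ
    let φ0 : A × B →* Equiv.Perm (Ω ⊕ B) :=
      (Equiv.Perm.sumCongrHom Ω B).comp
        ((P.subtype.comp i.toMonoidHom).prodMap (MulAction.toPermHom B B))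
    have hφ0 : Function.Injective φ0 := by
      rw [injective_iff_map_eq_one]
      rintro ⟨a, b⟩ hab
      have ha : i a = 1 := by
        ext z
        exact Sum.inl_injective (Equiv.congr_fun hab (Sum.inl z))
      have hb : b * 1 = 1 := Sum.inr_injective (Equiv.congr_fun hab (Sum.inr 1))
      exact Prod.ext (by simpa using ha) (by simpa using hb)
    have key : ∀ p, ∀ hp : p ∈ P, φ0 (E.symm (E (i.symm ⟨p, hp⟩, 1))) = Equiv.sumCongr p 1 := by
      intro p hp
      rw [E.symm_apply_apply]
      ext z
      rcases z with z | z <;> simp [φ0]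
    obtain ⟨g, hg⟩ := t2c_hom h (φ0.comp E.symm.toMonoidHom)
      (hφ0.comp E.symm.injective) (Equiv.sumCongr θ 1) (by
        rintro (α | α) (β | β)
        · obtain ⟨p, hp, h1, h2⟩ := hθ α β
          refine ⟨E (i.symm ⟨p, hp⟩, 1), ?_⟩
          simp only [MonoidHom.comp_apply, MulEquiv.toMonoidHom_eq_coe, MonoidHom.coe_coe, key p hp]
          simp [h1, h2]
        · obtain ⟨p, hp, h1, h2⟩ := hθ α α
          refine ⟨E (i.symm ⟨p, hp⟩, 1), ?_⟩
          simp only [MonoidHom.comp_apply, MulEquiv.toMonoidHom_eq_coe, MonoidHom.coe_coe, key p hp]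
          simp [h1]
        · obtain ⟨p, hp, h1, h2⟩ := hθ β β
          refine ⟨E (i.symm ⟨p, hp⟩, 1), ?_⟩
          simp only [MonoidHom.comp_apply, MulEquiv.toMonoidHom_eq_coe, MonoidHom.coe_coe, key p hp]
          simp [h1]
        · exact ⟨1, by simp⟩)
    have : θ = i (E.symm g).1 := by
      ext z
      exact Sum.inl_injective (Equiv.congr_fun hg (Sum.inl z))
    rw [this]
    exact (i _).2
  · intro p hp α β
    exact ⟨p, hp, rfl, rfl⟩

open scoped Pointwise in
theorem t2c_sup {G : Type*} [Group G] [Finite G] (h2c : IsTotally2Closed G)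
    (H K : Subgroup G)
    (hHK : (H : Set G) * (K : Set G) = Set.univ)
    (hcore : H.normalCore ⊓ K.normalCore = ⊥) :
    H.normalCore ⊔ K.normalCore = ⊤ := by
  let φ : G →* Equiv.Perm ((G ⧸ H) ⊕ (G ⧸ K)) :=
    (Equiv.Perm.sumCongrHom _ _).comp
      ((MulAction.toPermHom G (G ⧸ H)).prod (MulAction.toPermHom G (G ⧸ K)))
  have hl : ∀ g z, φ g (Sum.inl z) = Sum.inl (g • z) := fun _ _ => rfl
  have hr : ∀ g z, φ g (Sum.inr z) = Sum.inr (g • z) := fun _ _ => rfl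
  have coreK : ∀ (L : Subgroup G) (g : G), (∀ z : G ⧸ L, g • z = z) → g ∈ L.normalCore := by
    intro L g hg
    rw [Subgroup.normalCore_eq_ker, MonoidHom.mem_ker]
    exact Equiv.ext hg
  have hφ : Function.Injective φ := by
    rw [injective_iff_map_eq_one]
    intro g hg
    have : g ∈ H.normalCore ⊓ K.normalCore :=
      ⟨coreK H g fun z => Sum.inl_injective (Equiv.congr_fun hg (Sum.inl z)),
       coreK K g fun z => Sum.inr_injective (Equiv.congr_fun hg (Sum.inr z))⟩
    rwa [hcore, Subgroup.mem_bot] at this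
  -- transitivity on pairs
  have trans0 : ∀ (a b : G), ∃ g : G, g • ((1 : G) : G ⧸ H) = (a : G ⧸ H) ∧
      g • ((1 : G) : G ⧸ K) = (b : G ⧸ K) := by
    intro a b
    have : a⁻¹ * b ∈ (H : Set G) * (K : Set G) := hHK ▸ Set.mem_univ _
    obtain ⟨x, hx, y, hy, hxy⟩ := this
    refine ⟨a * x, ?_, ?_⟩
    · rw [MulAction.Quotient.smul_coe, QuotientGroup.eq]
      simpa using hx
    · rw [MulAction.Quotient.smul_coe, QuotientGroup.eq]
      have : b = a * x * y := by
        have hxy' : x * y = a⁻¹ * b := hxy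
        rw [mul_assoc, hxy']; simp
      have h3 : (a * x * 1)⁻¹ * b = y := by rw [this]; group
      rw [smul_eq_mul, h3]
      exact hy
  have trans : ∀ (α α' : G ⧸ H) (β β' : G ⧸ K), ∃ g : G, α' = g • α ∧ β' = g • β := by
    intro α α' β β'
    induction α using QuotientGroup.induction_on with | H a => ?_
    induction α' using QuotientGroup.induction_on with | H a' => ?_
    induction β using QuotientGroup.induction_on with | H b => ?_
    induction β' using QuotientGroup.induction_on with | H b' => ?_
    obtain ⟨g, h1, h2⟩ := trans0 a b
    obtain ⟨g', h1', h2'⟩ := trans0 a' b'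
    refine ⟨g' * g⁻¹, ?_, ?_⟩
    · rw [← h1, ← h1', mul_smul, inv_smul_smul]
    · rw [← h2, ← h2', mul_smul, inv_smul_smul]
  rw [eq_top_iff]
  intro g _
  obtain ⟨k, hk⟩ := t2c_hom h2c φ hφ (Equiv.sumCongr (MulAction.toPerm g) 1) (by
    rintro (α | α) (β | β)
    · exact ⟨g, rfl, rfl⟩
    · obtain ⟨k, h1, h2⟩ := trans α (g • α) β β
      exact ⟨k, congrArg Sum.inl h1, congrArg Sum.inr h2⟩
    · obtain ⟨k, h1, h2⟩ := trans β (g • β) α α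
      exact ⟨k, congrArg Sum.inr h2, congrArg Sum.inl h1⟩
    · exact ⟨1, by simp⟩)
  have h1 : k ∈ K.normalCore :=
    coreK K k fun z => (Sum.inr_injective (Equiv.congr_fun hk (Sum.inr z))).symm
  have h2 : g * k⁻¹ ∈ H.normalCore := coreK H _ fun z => by
    have : g • (k⁻¹ • z) = k • (k⁻¹ • z) :=
      Sum.inl_injective (Equiv.congr_fun hk (Sum.inl (k⁻¹ • z)))
    rw [mul_smul, this, smul_inv_smul]
  have := Subgroup.mul_mem_sup h2 h1
  simpa using this

open scoped Pointwise in
theorem totally_two_closed_factorization_cores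
    (G : Type*) [Group G] [Finite G] (h2c : IsTotally2Closed G)
    (H K : Subgroup G) (hH : H ≠ ⊤) (hK : K ≠ ⊤)
    (hHK : (H : Set G) * (K : Set G) = Set.univ)
    (hcore : H.normalCore ⊓ K.normalCore = ⊥) :
    H.normalCore.Normal ∧ K.normalCore.Normal ∧
      H.normalCore ⊔ K.normalCore = ⊤ ∧
      IsTotally2Closed H.normalCore ∧ IsTotally2Closed K.normalCore := by
  have hs := t2c_sup h2c H K hHK hcore
  refine ⟨inferInstance, inferInstance, hs, t2c_factor h2c _ _ hcore hs, ?_⟩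
  rw [inf_comm] at hcore
  rw [sup_comm] at hs
  exact t2c_factor h2c _ _ hcore hs
end

section
/- Let G be a finite totally 2-closed group and suppose G = HK for proper subgroups H and K of G with H ∩ K = 1. Then H and K are normal in G, G is the internal direct product G = H × K, and both H and K are totally 2-closed. -/
universe u v w

theorem t2c_key1 {G : Type u} [Group G] (h : IsTotally2Closed.{u, v} G) {Y : Type v}
    (φ : G →* Equiv.Perm Y) (hφ : Function.Injective φ) (θ : Equiv.Perm Y)
    (hθ : ∀ a b, ∃ g, θ a = φ g a ∧ θ b = φ g b) : ∃ g, θ = φ g := by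
  have h1 := h Y φ.range ⟨MonoidHom.ofInjective hφ⟩
  have h2 : θ ∈ twoClosure φ.range := by
    intro a b
    obtain ⟨g, h1, h2⟩ := hθ a b
    exact ⟨φ g, ⟨g, rfl⟩, h1, h2⟩
  rw [h1] at h2
  obtain ⟨g, hg⟩ := h2
  exact ⟨g, hg.symm⟩

theorem t2c_key2 {G : Type u} [Group G] (h : IsTotally2Closed.{u, v} G) {X : Type w} [Finite X]
    [MulAction G X] (hf : ∀ g : G, (∀ x : X, g • x = x) → g = 1) (θ : X → X)
    (hθ : ∀ a b, ∃ g : G, θ a = g • a ∧ θ b = g • b) : ∃ g : G, ∀ x, θ x = g • x := by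
  have hinj : Function.Injective θ := by
    intro a b hab
    obtain ⟨g, h1, h2⟩ := hθ a b
    rw [h1, h2] at hab
    exact MulAction.injective g hab
  haveI : Small.{v} X := Countable.toSmall X
  let e : X ≃ Shrink.{v} X := equivShrink.{v} X
  let φ : G →* Equiv.Perm (Shrink.{v} X) :=
    (e.permCongrHom).toMonoidHom.comp (MulAction.toPermHom G X)
  have hφ : ∀ g y, φ g y = e (g • e.symm y) := fun g y => rfl
  let θ' : Equiv.Perm X := Equiv.ofBijective θ (Finite.injective_iff_bijective.mp hinj)
  obtain ⟨g, hg⟩ := t2c_key1 h φ (by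
    rw [injective_iff_map_eq_one]
    intro g hg
    apply hf
    intro x
    have := hφ g (e x)
    rw [hg] at this
    simpa using this.symm) (e.permCongr θ') (by
    intro a b
    obtain ⟨g, h1, h2⟩ := hθ (e.symm a) (e.symm b)
    refine ⟨g, ?_, ?_⟩
    · rw [hφ, ← h1]; rfl
    · rw [hφ, ← h2]; rfl)
  refine ⟨g, fun x => ?_⟩
  have h1 := congrArg (fun p => p (e x)) hg
  simp only [hφ, Equiv.permCongr_apply, Equiv.symm_apply_apply] at h1
  exact e.injective h1

theorem t2c_key3 {G : Type u} [Group G] [Finite G] (h : IsTotally2Closed.{u, v} G) {X : Type w}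
    [MulAction G X] (hf : ∀ g : G, (∀ x : X, g • x = x) → g = 1) (θ : X → X)
    (hθ : ∀ a b, ∃ g : G, θ a = g • a ∧ θ b = g • b) : ∃ g : G, ∀ x, θ x = g • x := by
  rcases isEmpty_or_nonempty X with hX | ⟨⟨x0⟩⟩
  · exact ⟨1, fun x => (hX.false x).elim⟩
  have h1 : ∀ g : G, ∃ x : X, g • x = x → g = 1 := by
    intro g
    by_contra! hc
    exact (hc x0).2 (hf g fun x => (hc x).1)
  choose f hf' using h1
  have claim : ∀ x, ∃ g : G, θ x = g • x ∧ ∀ g', θ (f g') = g • f g' := by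
    intro x
    let F : G × Option G → X := fun p => p.1 • (p.2.elim x f)
    let Δ : SubMulAction G X :=
      { carrier := Set.range F
        smul_mem' := by
          rintro c _ ⟨⟨a, b⟩, rfl⟩
          exact ⟨(c * a, b), mul_smul _ _ _⟩ }
    have hmem : ∀ y, y ∈ Δ ↔ y ∈ Set.range F := fun y => Iff.rfl
    have : Finite Δ := (Set.finite_range F).to_subtype
    have hx : x ∈ Δ := ⟨(1, none), one_smul _ _⟩
    have hfx : ∀ g, f g ∈ Δ := fun g => ⟨(1, some g), one_smul _ _⟩
    have hθΔ : ∀ y ∈ Δ, θ y ∈ Δ := by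
      intro y hy
      obtain ⟨g, h1, -⟩ := hθ y y
      rw [h1]
      exact Δ.smul_mem g hy
    obtain ⟨g, hg⟩ := t2c_key2 h (X := Δ) (by
      intro g hg
      exact hf' g (congrArg Subtype.val (hg ⟨f g, hfx g⟩)))
      (fun y => ⟨θ y, hθΔ y y.2⟩) (by
      intro a b
      obtain ⟨g, h1, h2⟩ := hθ a b
      exact ⟨g, Subtype.ext h1, Subtype.ext h2⟩)
    exact ⟨g, congrArg Subtype.val (hg ⟨x, hx⟩),
      fun g' => congrArg Subtype.val (hg ⟨f g', hfx g'⟩)⟩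
  obtain ⟨g0, -, h0⟩ := claim x0
  refine ⟨g0, fun x => ?_⟩
  obtain ⟨g, hx, hg⟩ := claim x
  have : g0⁻¹ * g = 1 := by
    apply hf'
    rw [mul_smul, ← hg, h0, inv_smul_smul]
  rw [inv_mul_eq_one] at this
  rw [this, hx]

theorem t2c_prod {G : Type u} [Group G] [Finite G] (h : IsTotally2Closed.{u, v} G)
    {A B : Type u} [Group A] [Group B] (e : G ≃* A × B) : IsTotally2Closed.{u, w} A := by
  rintro Ω L ⟨ψ⟩
  apply le_antisymm
  · intro θ hθ
    letI : MulAction G (Ω ⊕ B) :=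
      { smul := fun g => Sum.map (fun x => (ψ (e g).1 : Equiv.Perm Ω) x) (fun b => (e g).2 * b)
        one_smul := by
          rintro (x | b)
          · change Sum.inl ((ψ (e 1).1 : Equiv.Perm Ω) x) = _
            simp
          · change Sum.inr ((e 1).2 * b) = _
            simp
        mul_smul := by
          rintro g g' (x | b)
          · change Sum.inl ((ψ (e (g * g')).1 : Equiv.Perm Ω) x) =
              Sum.inl ((ψ (e g).1 : Equiv.Perm Ω) ((ψ (e g').1 : Equiv.Perm Ω) x))
            simp
          · change Sum.inr ((e (g * g')).2 * b) = Sum.inr ((e g).2 * ((e g').2 * b))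
            simp [mul_assoc] }
    have hl : ∀ (g : G) (x : Ω), g • (Sum.inl x : Ω ⊕ B) =
      Sum.inl ((ψ (e g).1 : Equiv.Perm Ω) x) := fun _ _ => rfl
    have hr : ∀ (g : G) (b : B), g • (Sum.inr b : Ω ⊕ B) = Sum.inr ((e g).2 * b) :=
      fun _ _ => rfl
    have lift : ∀ l ∈ L, ∃ g : G, (∀ x, g • (Sum.inl x : Ω ⊕ B) = Sum.inl (l x)) ∧
        ∀ b, g • (Sum.inr b : Ω ⊕ B) = Sum.inr b := by
      intro l hl'
      refine ⟨e.symm (ψ.symm ⟨l, hl'⟩, 1), fun x => ?_, fun b => ?_⟩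
      · rw [hl]; simp
      · rw [hr]; simp
    obtain ⟨g, hg⟩ := t2c_key3 h (X := Ω ⊕ B) (by
      intro g hg
      apply e.injective
      rw [map_one]
      ext
      · apply ψ.injective
        rw [Prod.fst_one, map_one]
        ext x
        have := hg (Sum.inl x)
        rw [hl] at this
        exact Sum.inl.inj this
      · have := hg (Sum.inr 1)
        rw [hr] at this
        simpa using Sum.inr.inj this) (Sum.map θ id) (by
      rintro (a | a) (b | b)
      · obtain ⟨l, hl', h1, h2⟩ := hθ a b
        obtain ⟨g, hg1, hg2⟩ := lift l hl'
        exact ⟨g, by simp [hg1, h1], by simp [hg1, h2]⟩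
      · obtain ⟨l, hl', h1, h2⟩ := hθ a a
        obtain ⟨g, hg1, hg2⟩ := lift l hl'
        exact ⟨g, by simp [hg1, h1], by simp [hg2]⟩
      · obtain ⟨l, hl', h1, h2⟩ := hθ b b
        obtain ⟨g, hg1, hg2⟩ := lift l hl'
        exact ⟨g, by simp [hg2], by simp [hg1, h1]⟩
      · exact ⟨1, by simp, by simp⟩)
    have : θ = (ψ (e g).1 : Equiv.Perm Ω) := by
      ext x
      have := hg (Sum.inl x)
      rw [hl] at this
      exact Sum.inl.inj this
    rw [this]
    exact (ψ (e g).1).2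
  · intro l hl a b
    exact ⟨l, hl, rfl, rfl⟩

/-- Every element of `G` is a product of elements of the two cores. -/
theorem t2c_core {G : Type u} [Group G] [Finite G] (h : IsTotally2Closed.{u, v} G)
    (H K : Subgroup G) (hHK : ∀ g : G, ∃ a ∈ H, ∃ b ∈ K, a * b = g) (hint : H ⊓ K = ⊥)
    (g1 : G) : ∃ g : G, (∀ x : G ⧸ H, g1 • x = g • x) ∧ ∀ x : G ⧸ K, x = g • x := by
  have trans : ∀ (x y : G ) (x' y' : G), ∃ g : G, (x' : G ⧸ H) = g • (x : G ⧸ H) ∧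
      (y' : G ⧸ K) = g • (y : G ⧸ K) := by
    intro x y x' y'
    -- `g = x' a x⁻¹ = y' b y⁻¹`, so `a (x⁻¹ y) b⁻¹ = x'⁻¹ y'`
    obtain ⟨a, ha, b, hb, hab⟩ := hHK (x⁻¹ * y)
    obtain ⟨c, hc, d, hd, hcd⟩ := hHK (x'⁻¹ * y')
    refine ⟨x' * c * a⁻¹ * x⁻¹, ?_, ?_⟩
    · rw [MulAction.Quotient.smul_coe, QuotientGroup.eq]
      have : x'⁻¹ * (x' * c * a⁻¹ * x⁻¹) • x = c * a⁻¹ := by simp [mul_assoc]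
      rw [this]
      exact H.mul_mem hc (H.inv_mem ha)
    · rw [MulAction.Quotient.smul_coe, QuotientGroup.eq]
      have hy : y = x * (a * b) := by rw [hab]; group
      have hy' : y' = x' * (c * d) := by rw [hcd]; group
      have : y'⁻¹ * (x' * c * a⁻¹ * x⁻¹) • y = d⁻¹ * b := by
        rw [hy, hy', smul_eq_mul]; group
      rw [this]
      exact K.mul_mem (K.inv_mem hd) hb
  obtain ⟨g, hg⟩ := t2c_key3 h (X := (G ⧸ H) ⊕ (G ⧸ K)) (by
    intro g hg
    have h1 : g • ((1 : G) : G ⧸ H) = ((1 : G) : G ⧸ H) := Sum.inl.inj (hg (Sum.inl _))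
    have h2 : g • ((1 : G) : G ⧸ K) = ((1 : G) : G ⧸ K) := Sum.inr.inj (hg (Sum.inr _))
    rw [MulAction.Quotient.smul_coe, eq_comm, QuotientGroup.eq] at h1 h2
    rw [← Subgroup.mem_bot, ← hint]
    exact ⟨by simpa using h1, by simpa using h2⟩)
    (Sum.map (fun x => g1 • x) id) (by
    rintro (a | a) (b | b)
    · exact ⟨g1, rfl, rfl⟩
    · induction a using QuotientGroup.induction_on with | H x
      induction b using QuotientGroup.induction_on with | H y
      obtain ⟨g, h1, h2⟩ := trans x y (g1 * x) y
      exact ⟨g, congrArg Sum.inl h1, congrArg Sum.inr h2⟩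
    · induction a using QuotientGroup.induction_on with | H y
      induction b using QuotientGroup.induction_on with | H x
      obtain ⟨g, h1, h2⟩ := trans x y (g1 * x) y
      exact ⟨g, congrArg Sum.inr h2, congrArg Sum.inl h1⟩
    · exact ⟨1, by simp, by simp⟩)
  exact ⟨g, fun x => Sum.inl.inj (hg (Sum.inl x)), fun x => Sum.inr.inj (hg (Sum.inr x))⟩

theorem t2c_normal {G : Type u} [Group G] [Finite G] (h : IsTotally2Closed.{u, v} G)
    (H K : Subgroup G) (hHK : ∀ g : G, ∃ a ∈ H, ∃ b ∈ K, a * b = g) (hint : H ⊓ K = ⊥) :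
    H.Normal := by
  refine ⟨fun n hn c => ?_⟩
  obtain ⟨g, h1, h2⟩ := t2c_core h H K hHK hint n
  have hgK : g ∈ K := by
    have := h2 ((1 : G) : G ⧸ K)
    rw [MulAction.Quotient.smul_coe, QuotientGroup.eq] at this
    simpa using this
  have hgH : g ∈ H := by
    have := h1 ((1 : G) : G ⧸ H)
    rw [MulAction.Quotient.smul_coe, MulAction.Quotient.smul_coe, QuotientGroup.eq] at this
    have h3 : n⁻¹ * g ∈ H := by simpa using this
    exact (H.mul_mem_cancel_left (H.inv_mem hn)).mp h3
  have hg1 : g = 1 := by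
    rw [← Subgroup.mem_bot, ← hint]
    exact ⟨hgH, hgK⟩
  have := h1 ((c⁻¹ : G) : G ⧸ H)
  rw [hg1, one_smul, eq_comm, MulAction.Quotient.smul_coe, QuotientGroup.eq] at this
  simpa [mul_assoc] using this

open scoped Pointwise in
theorem totally_two_closed_factorization_trivial_intersection
    (G : Type*) [Group G] [Finite G] (h2c : IsTotally2Closed G)
    (H K : Subgroup G) (hH : H ≠ ⊤) (hK : K ≠ ⊤)
    (hHK : (H : Set G) * (K : Set G) = Set.univ)
    (hint : H ⊓ K = ⊥) :
    H.Normal ∧ K.Normal ∧ H ⊔ K = ⊤ ∧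
      IsTotally2Closed H ∧ IsTotally2Closed K := by
  have h1 : ∀ g : G, ∃ a ∈ H, ∃ b ∈ K, a * b = g := by
    intro g
    have : g ∈ (H : Set G) * (K : Set G) := by rw [hHK]; trivial
    exact Set.mem_mul.mp this
  have h2 : ∀ g : G, ∃ a ∈ K, ∃ b ∈ H, a * b = g := by
    intro g
    obtain ⟨a, ha, b, hb, hab⟩ := h1 g⁻¹
    exact ⟨b⁻¹, K.inv_mem hb, a⁻¹, H.inv_mem ha, by rw [← mul_inv_rev, hab, inv_inv]⟩
  have nH : H.Normal := t2c_normal h2c H K h1 hint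
  have nK : K.Normal := t2c_normal h2c K H h2 (by rw [inf_comm, hint])
  have hcomm : ∀ (x : H) (y : K), Commute (H.subtype x) (K.subtype y) := fun x y =>
    Subgroup.commute_of_normal_of_disjoint H K nH nK (disjoint_iff.mpr hint) x y x.2 y.2
  let f : H × K →* G := MonoidHom.noncommCoprod H.subtype K.subtype hcomm
  have hf : ∀ p, f p = (p.1 : G) * p.2 := fun p => rfl
  have hbij : Function.Bijective f := by
    constructor
    · rw [injective_iff_map_eq_one]
      rintro ⟨⟨a, ha⟩, ⟨b, hb⟩⟩ hab
      rw [hf] at hab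
      simp only at hab
      have hab' : a = b⁻¹ := eq_inv_of_mul_eq_one_left hab
      have ha1 : a = 1 := by
        rw [← Subgroup.mem_bot, ← hint]
        exact ⟨ha, hab' ▸ K.inv_mem hb⟩
      subst ha1
      have hb1 : b = 1 := by simpa using hab
      subst hb1
      rfl
    · intro g
      obtain ⟨a, ha, b, hb, hab⟩ := h1 g
      exact ⟨(⟨a, ha⟩, ⟨b, hb⟩), hab⟩
  let e : G ≃* H × K := (MulEquiv.ofBijective f hbij).symm
  refine ⟨nH, nK, ?_, t2c_prod h2c e, t2c_prod h2c (e.trans MulEquiv.prodComm)⟩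
  rw [eq_top_iff]
  intro g _
  obtain ⟨a, ha, b, hb, hab⟩ := h1 g
  rw [← hab]
  exact Subgroup.mul_mem_sup ha hb
end
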